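/- Let q ≥ 121 be an odd prime power and let E be an elliptic curve over F_q in canonical form Y² = X³ + aX² + bX + c with j(E) ≠ 0, the coordinate frame chosen so that the line X = 0 meets E in two affine F_q-rational points both distinct from (0,0), and the lines Y = 0 and X = Y each meet E in three affine F_q-rational points. If a point Q = (Q₁ : Q₂ : Q₃ : Q₄ : Q₅) ∈ P⁴(F_q) \ φ₅(E(F_q)) can be added to the (n; 5, 3)-set φ₅(E(F_q)) (i.e., no hyperplane of P⁴(F_q) through Q meets φ₅(E(F_q)) in 5 points), then Q₅Q₂ ≠ 0, Q₄ = 0, and the affine point (1, 0, Q₅/Q₂), i.e. (X,Y) = (0, Q₅/Q₂), lies on E. -/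

import Mathlib

set_option linter.unusedSectionVars false

namespace NMDS

open WeierstrassCurve

variable {F : Type} [Field F] [Fintype F] [DecidableEq F]

/-- `ψ_i(X,Y)`: `Y^s` if `i = 3s` (`s ≥ 1`), `X·Y^s` if `i = 3s+2` (`s ≥ 0`),
`X²·Y^s` if `i = 3s+4` (`s ≥ 0`). -/
def psi (i : ℕ) (X Y : F) : F :=
  if i % 3 = 0 then Y ^ (i / 3)
  else if i % 3 = 2 then X * Y ^ (i / 3)
  else X ^ 2 * Y ^ ((i - 4) / 3)

/-- The coordinate vector of `φ_k(P)`: `(1, ψ₂(P), …, ψ_k(P))` for an affine point `P`,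
and `(0, …, 0, 1)` for the point at infinity. -/
def phiVec (W : WeierstrassCurve F) (k : ℕ) : W.toAffine.Point → (Fin k → F)
  | .zero => fun j => if (j : ℕ) = k - 1 then 1 else 0
  | .some (x := x) (y := y) _ => fun j => if (j : ℕ) = 0 then 1 else psi ((j : ℕ) + 1) x y

lemma phiVec_ne_zero (W : WeierstrassCurve F) {k : ℕ} (hk : 0 < k)
    (P : W.toAffine.Point) : phiVec W k P ≠ 0 := by
  cases P with
  | zero =>
    intro h
    have := congrFun h ⟨k - 1, by omega⟩
    simp [phiVec] at this
  | some h' =>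
    intro h
    have := congrFun h ⟨0, hk⟩
    simp [phiVec] at this

/-- The image of a rational point of `E` in `P^{k-1}(F_q)` under `φ_k`. -/
noncomputable def phiProj (W : WeierstrassCurve F) {k : ℕ} (hk : 0 < k)
    (P : W.toAffine.Point) : Projectivization F (Fin k → F) :=
  Projectivization.mk F (phiVec W k P) (phiVec_ne_zero W hk P)

/-- The `k`-elliptic code associated to `E`, relative to an enumeration `e` of the `n`
rational points of `E`: the span of the rows of the `k × n` matrix whose `j`-th column
is `φ_k(P_j)`. -/
def ellipticCode (W : WeierstrassCurve F) (k : ℕ) {n : ℕ}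
    (e : Fin n ≃ W.toAffine.Point) : Submodule F (Fin n → F) :=
  Submodule.span F (Set.range fun i : Fin k => fun j : Fin n => phiVec W k (e j) i)

/-- The minimum distance (= minimum weight) of a linear code. -/
noncomputable def minDist {n : ℕ} (C : Submodule F (Fin n → F)) : ℕ :=
  sInf {d | ∃ x ∈ C, x ≠ 0 ∧ hammingNorm x = d}

/-- The standard inner product with `y` as a linear map. -/
def dotLin {n : ℕ} (y : Fin n → F) : (Fin n → F) →ₗ[F] F where
  toFun x := ∑ i, x i * y i
  map_add' a b := by simp [add_mul, Finset.sum_add_distrib]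
  map_smul' c a := by simp [Finset.mul_sum, mul_assoc]

/-- The dual code: all vectors orthogonal to every codeword. -/
def dualCode {n : ℕ} (C : Submodule F (Fin n → F)) : Submodule F (Fin n → F) :=
  ⨅ y ∈ C, LinearMap.ker (dotLin y)

/-- The Singleton defect `s(C) = n - k + 1 - d` of a code of length `n`. -/
noncomputable def singletonDefect {n : ℕ} (C : Submodule F (Fin n → F)) : ℤ :=
  (n : ℤ) + 1 - Module.finrank F C - minDist C

/-- A code is MDS if its Singleton defect is zero. -/
noncomputable def IsMDS {n : ℕ} (C : Submodule F (Fin n → F)) : Prop :=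
  singletonDefect C = 0

/-- A code is near-MDS if both it and its dual have Singleton defect one. -/
noncomputable def IsNMDS {n : ℕ} (C : Submodule F (Fin n → F)) : Prop :=
  singletonDefect C = 1 ∧ singletonDefect (dualCode C) = 1

/-- An `[n,k,d]_q` code `C` is `h`-extendable if there is an `[n+h,k,d+h]_q` code `C'`
whose projection on the first `n` coordinates is `C`. -/
noncomputable def IsHExtendable {n : ℕ} (h : ℕ) (C : Submodule F (Fin n → F)) : Prop :=
  ∃ C' : Submodule F (Fin (n + h) → F),
    Module.finrank F C' = Module.finrank F C ∧
    minDist C' = minDist C + h ∧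
    Submodule.map (LinearMap.funLeft F F (Fin.castAdd h)) C' = C

/-- The point `p` of `P^{k-1}(F_q)` lies on the hyperplane with coefficient vector `a`. -/
def OnHyp {k : ℕ} (a : Fin k → F) (p : Projectivization F (Fin k → F)) : Prop :=
  ∑ i, a i * p.rep i = 0

/-- An `(·; k, k-2)`-set in `P^{k-1}(F_q)`: no `k+1` of its points lie on a common hyperplane,
i.e. every hyperplane contains at most `k` of its points. -/
def IsArcSet (k : ℕ) (S : Set (Projectivization F (Fin k → F))) : Prop :=
  ∀ a : Fin k → F, a ≠ 0 → Set.ncard {p ∈ S | OnHyp a p} ≤ k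

/-- A complete `(·; k, k-2)`-set: maximal with respect to set-theoretical inclusion. -/
def IsCompleteArcSet (k : ℕ) (S : Set (Projectivization F (Fin k → F))) : Prop :=
  IsArcSet k S ∧ ∀ T, IsArcSet k T → S ⊆ T → T = S

/-- Evaluation of the homogeneous cubic of a Weierstrass curve:
`Y²Z + a₁XYZ + a₃YZ² - X³ - a₂X²Z - a₄XZ² - a₆Z³`. -/
def cubicEval {R : Type*} [CommRing R] (W : WeierstrassCurve R) (x y z : R) : R :=
  y ^ 2 * z + W.a₁ * x * y * z + W.a₃ * y * z ^ 2
    - (x ^ 3 + W.a₂ * x ^ 2 * z + W.a₄ * x * z ^ 2 + W.a₆ * z ^ 3)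

/-- The gradient of the homogeneous cubic of a Weierstrass curve. -/
def gradEval {R : Type*} [CommRing R] (W : WeierstrassCurve R) (x y z : R) : Fin 3 → R :=
  ![W.a₁ * y * z - (3 * x ^ 2 + 2 * W.a₂ * x * z + W.a₄ * z ^ 2),
    2 * y * z + W.a₁ * x * z + W.a₃ * z ^ 2,
    y ^ 2 + W.a₁ * x * y + 2 * W.a₃ * y * z - (W.a₂ * x ^ 2 + 2 * W.a₄ * x * z + 3 * W.a₆ * z ^ 2)]

/-- The point `p` of `P²(F_q)` lies on the plane cubic `E`. -/
def OnCurve (W : WeierstrassCurve F) (p : Projectivization F (Fin 3 → F)) : Prop :=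
  cubicEval W (p.rep 0) (p.rep 1) (p.rep 2) = 0

/-- A line of `P²(F_q)`, given by its coefficient vector `l`, is a tangent of `E`:
it touches the curve at some point (over the algebraic closure) with multiplicity at
least two, i.e. it is the tangent line of the cubic at a contact point. -/
def IsTangentLine (W : WeierstrassCurve F) (l : Fin 3 → F) : Prop :=
  ∃ v : Fin 3 → AlgebraicClosure F, v ≠ 0 ∧
    cubicEval (W.baseChange (AlgebraicClosure F)) (v 0) (v 1) (v 2) = 0 ∧
    (∑ i, algebraMap F (AlgebraicClosure F) (l i) * v i) = 0 ∧
    ∃ t : AlgebraicClosure F, t ≠ 0 ∧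
      gradEval (W.baseChange (AlgebraicClosure F)) (v 0) (v 1) (v 2) =
        t • fun i => algebraMap F (AlgebraicClosure F) (l i)

/-- A line of `P²(F_q)` intersects `E` in three distinct `F_q`-rational points. -/
def IsThreeSecant (W : WeierstrassCurve F) (l : Fin 3 → F) : Prop :=
  ∃ u v w : Projectivization F (Fin 3 → F), u ≠ v ∧ u ≠ w ∧ v ≠ w ∧
    OnCurve W u ∧ OnCurve W v ∧ OnCurve W w ∧ OnHyp l u ∧ OnHyp l v ∧ OnHyp l w

section

open Polynomial

/-- Auxiliary data for Stepanov's method: the Hasse derivatives `Dᵢ` of a polynomial `D`, the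
numerators `Cᵢ` of the Taylor coefficients of its square root, and a Padé type relation. -/
structure StepanovData (F : Type) [Field F] where
  D : F[X]
  D1 : F[X]
  D2 : F[X]
  D3 : F[X]
  D4 : F[X]
  D5 : F[X]
  D6 : F[X]
  C1 : F[X]
  C2 : F[X]
  C3 : F[X]
  C4 : F[X]
  C5 : F[X]
  C6 : F[X]
  a0 : F[X]
  a1 : F[X]
  a2 : F[X]
  taylor : ∀ x : F, C (D.eval x) = D + D1 * (C x - X) + D2 * (C x - X) ^ 2 + D3 * (C x - X) ^ 3 +
    D4 * (C x - X) ^ 4 + D5 * (C x - X) ^ 5 + D6 * (C x - X) ^ 6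
  sq1 : 2 * C1 = D1
  sq2 : 2 * C2 + C1 ^ 2 = D2 * D
  sq3 : 2 * C3 + 2 * C1 * C2 = D3 * D ^ 2
  sq4 : 2 * C4 + 2 * C1 * C3 + C2 ^ 2 = D4 * D ^ 3
  sq5 : 2 * C5 + 2 * C1 * C4 + 2 * C2 * C3 = D5 * D ^ 4
  sq6 : 2 * C6 + 2 * C1 * C5 + 2 * C2 * C4 + C3 ^ 2 = D6 * D ^ 5
  pade5 : a0 * C5 + a1 * C4 + a2 * C3 = 0
  ne : a0 ≠ 0 ∨ a1 ≠ 0 ∨ a2 ≠ 0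

namespace StepanovData

variable {F : Type} [Field F] (S : StepanovData F)

/-- The numerator part of the auxiliary polynomial, as a function of the increment `h`. -/
noncomputable def r (h : F[X]) : F[X] :=
  S.D ^ 4 * S.a0 + S.D ^ 3 * (S.a0 * S.C1 + S.a1) * h +
  S.D ^ 2 * (S.a0 * S.C2 + S.a1 * S.C1 + S.a2) * h ^ 2 +
  S.D * (S.a0 * S.C3 + S.a1 * S.C2 + S.a2 * S.C1) * h ^ 3 +
  (S.a0 * S.C4 + S.a1 * S.C3 + S.a2 * S.C2) * h ^ 4

/-- The denominator part of the auxiliary polynomial, as a function of the increment `h`. -/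
noncomputable def s (h : F[X]) : F[X] :=
  S.D ^ 3 * S.a0 + S.D ^ 2 * S.a1 * h + S.D * S.a2 * h ^ 2

/-- The Padé relation of order `ℓ`. -/
def Order (ℓ : ℕ) : Prop :=
  ℓ = 6 ∨ (ℓ = 7 ∧ S.a0 * S.C6 + S.a1 * S.C5 + S.a2 * S.C4 = 0)

/-- The truncated square root. -/
noncomputable def root (h : F[X]) : F[X] :=
  S.D ^ 6 + S.C1 * S.D ^ 5 * h + S.C2 * S.D ^ 4 * h ^ 2 + S.C3 * S.D ^ 3 * h ^ 3 +
  S.C4 * S.D ^ 2 * h ^ 4 + S.C5 * S.D * h ^ 5 + S.C6 * h ^ 6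

/-- The Taylor expansion. -/
noncomputable def val (h : F[X]) : F[X] :=
  S.D + S.D1 * h + S.D2 * h ^ 2 + S.D3 * h ^ 3 + S.D4 * h ^ 4 + S.D5 * h ^ 5 + S.D6 * h ^ 6

lemma root_sq (h : F[X]) : h ^ 7 ∣ S.D ^ 11 * S.val h - S.root h ^ 2 := by
  refine ⟨-(2 * (S.C1 * S.C6 + S.C2 * S.C5 + S.C3 * S.C4) * S.D ^ 5 +
    (2 * S.C2 * S.C6 + 2 * S.C3 * S.C5 + S.C4 ^ 2) * S.D ^ 4 * h +
    2 * (S.C3 * S.C6 + S.C4 * S.C5) * S.D ^ 3 * h ^ 2 +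
    (2 * S.C4 * S.C6 + S.C5 ^ 2) * S.D ^ 2 * h ^ 3 + 2 * S.C5 * S.C6 * S.D * h ^ 4 +
    S.C6 ^ 2 * h ^ 5), ?_⟩
  unfold val root
  linear_combination (-S.D ^ 11 * h) * S.sq1 - S.D ^ 10 * h ^ 2 * S.sq2 - S.D ^ 9 * h ^ 3 * S.sq3
    - S.D ^ 8 * h ^ 4 * S.sq4 - S.D ^ 7 * h ^ 5 * S.sq5 - S.D ^ 6 * h ^ 6 * S.sq6

lemma pade (h : F[X]) {ℓ : ℕ} (hl : S.Order ℓ) :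
    h ^ ℓ ∣ S.D ^ 5 * S.r h - S.s h * S.root h := by
  have key : S.D ^ 5 * S.r h - S.s h * S.root h =
      -h ^ 6 * S.D ^ 3 * (S.a0 * S.C6 + S.a1 * S.C5 + S.a2 * S.C4)
      - h ^ 7 * (S.D ^ 2 * (S.a1 * S.C6 + S.a2 * S.C5) + S.D * S.a2 * S.C6 * h) := by
    unfold r s root
    linear_combination (-h ^ 5 * S.D ^ 4) * S.pade5
  rw [key]
  rcases hl with rfl | ⟨rfl, h6⟩
  · exact ⟨-S.D ^ 3 * (S.a0 * S.C6 + S.a1 * S.C5 + S.a2 * S.C4)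
      - h * (S.D ^ 2 * (S.a1 * S.C6 + S.a2 * S.C5) + S.D * S.a2 * S.C6 * h), by ring⟩
  · rw [h6]
    exact ⟨- (S.D ^ 2 * (S.a1 * S.C6 + S.a2 * S.C5) + S.D * S.a2 * S.C6 * h), by ring⟩

lemma r_sq (h : F[X]) {ℓ : ℕ} (hl : S.Order ℓ) :
    h ^ ℓ ∣ S.r h ^ 2 - S.s h ^ 2 * S.D * S.val h := by
  set T0 := S.a0 with hT0
  set T1 := S.a0 * S.C1 + S.a1 with hT1
  set T2 := S.a0 * S.C2 + S.a1 * S.C1 + S.a2 with hT2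
  set T3 := S.a0 * S.C3 + S.a1 * S.C2 + S.a2 * S.C1 with hT3
  set T4 := S.a0 * S.C4 + S.a1 * S.C3 + S.a2 * S.C2 with hT4
  set T6 := S.a0 * S.C6 + S.a1 * S.C5 + S.a2 * S.C4 with hT6
  set b0 := S.a0 ^ 2 with hb0
  set b1 := 2 * S.a0 * S.a1 with hb1
  set b2 := 2 * S.a0 * S.a2 + S.a1 ^ 2 with hb2
  set b3 := 2 * S.a1 * S.a2 with hb3
  set b4 := S.a2 ^ 2 with hb4
  have e1 : 2 * T0 * T1 = b0 * S.D1 + b1 := by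
    rw [← S.sq1]; simp only [hT0, hT1, hb0, hb1]; ring
  have e2 : 2 * T0 * T2 + T1 ^ 2 = b0 * (S.D2 * S.D) + b1 * S.D1 + b2 := by
    rw [← S.sq1, ← S.sq2]; simp only [hT0, hT1, hT2, hb0, hb1, hb2]; ring
  have e3 : 2 * T0 * T3 + 2 * T1 * T2 =
      b0 * (S.D3 * S.D ^ 2) + b1 * (S.D2 * S.D) + b2 * S.D1 + b3 := by
    rw [← S.sq1, ← S.sq2, ← S.sq3]; simp only [hT0, hT1, hT2, hT3, hb0, hb1, hb2, hb3]; ring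
  have e4 : 2 * T0 * T4 + 2 * T1 * T3 + T2 ^ 2 =
      b0 * (S.D4 * S.D ^ 3) + b1 * (S.D3 * S.D ^ 2) + b2 * (S.D2 * S.D) + b3 * S.D1 + b4 := by
    rw [← S.sq1, ← S.sq2, ← S.sq3, ← S.sq4]
    simp only [hT0, hT1, hT2, hT3, hT4, hb0, hb1, hb2, hb3, hb4]; ring
  have e5 : 2 * T1 * T4 + 2 * T2 * T3 = b0 * (S.D5 * S.D ^ 4) + b1 * (S.D4 * S.D ^ 3) +
      b2 * (S.D3 * S.D ^ 2) + b3 * (S.D2 * S.D) + b4 * S.D1 := by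
    rw [← S.sq1, ← S.sq2, ← S.sq3, ← S.sq4, ← S.sq5]
    simp only [hT1, hT2, hT3, hT4, hb0, hb1, hb2, hb3, hb4]
    linear_combination (-2 * S.a0) * S.pade5
  have e6 : 2 * T0 * T6 + 2 * T2 * T4 + T3 ^ 2 =
      b0 * (S.D6 * S.D ^ 5) + b1 * (S.D5 * S.D ^ 4) +
      b2 * (S.D4 * S.D ^ 3) + b3 * (S.D3 * S.D ^ 2) + b4 * (S.D2 * S.D) := by
    rw [← S.sq2, ← S.sq3, ← S.sq4, ← S.sq5, ← S.sq6]
    simp only [hT0, hT2, hT3, hT4, hT6, hb0, hb1, hb2, hb3, hb4]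
    linear_combination (-2) * (S.a0 * S.C1 + S.a1) * S.pade5
  have key : S.r h ^ 2 - S.s h ^ 2 * S.D * S.val h = h ^ 6 * (-2 * S.D ^ 2 * T0 * T6) + h ^ 7 *
      (2 * S.D * T3 * T4 + T4 ^ 2 * h - S.D * (S.D ^ 5 * b1 * S.D6 + S.D ^ 4 * b2 * S.D5 +
        S.D ^ 3 * b3 * S.D4 + S.D ^ 2 * b4 * S.D3 + h * (S.D ^ 4 * b2 * S.D6 + S.D ^ 3 * b3 * S.D5 +
        S.D ^ 2 * b4 * S.D4) + h ^ 2 * (S.D ^ 3 * b3 * S.D6 + S.D ^ 2 * b4 * S.D5) +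
        h ^ 3 * S.D ^ 2 * b4 * S.D6)) := by
    have hs : S.s h ^ 2 = S.D ^ 6 * b0 + S.D ^ 5 * b1 * h + S.D ^ 4 * b2 * h ^ 2 +
        S.D ^ 3 * b3 * h ^ 3 + S.D ^ 2 * b4 * h ^ 4 := by
      simp only [s, hb0, hb1, hb2, hb3, hb4]; ring
    have hr : S.r h = S.D ^ 4 * T0 + S.D ^ 3 * T1 * h + S.D ^ 2 * T2 * h ^ 2 + S.D * T3 * h ^ 3 +
        T4 * h ^ 4 := rfl
    have e0 : T0 ^ 2 = b0 := rfl
    rw [hs, hr, val]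
    clear_value T0 T1 T2 T3 T4 T6 b0 b1 b2 b3 b4
    linear_combination S.D ^ 8 * e0 + S.D ^ 7 * h * e1 + S.D ^ 6 * h ^ 2 * e2 +
      S.D ^ 5 * h ^ 3 * e3 + S.D ^ 4 * h ^ 4 * e4 + S.D ^ 3 * h ^ 5 * e5 + S.D ^ 2 * h ^ 6 * e6
  rw [key]
  rcases hl with rfl | ⟨rfl, h6⟩
  · exact dvd_add (dvd_mul_right _ _) (Dvd.dvd.mul_right (pow_dvd_pow _ (by norm_num)) _)
  · have : T6 = 0 := h6
    rw [this, mul_zero, mul_zero, zero_add]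
    exact dvd_mul_right _ _

end StepanovData

namespace StepanovData

variable {F : Type} [Field F] [Fintype F] (S : StepanovData F)

/-- The auxiliary polynomial of Stepanov's method. -/
noncomputable def aux : F[X] :=
  S.r (X ^ Fintype.card F - X) + S.s (X ^ Fintype.card F - X) * S.D ^ ((Fintype.card F + 1) / 2)

lemma X_pow_card_sub (x : F) :
    (X : F[X]) ^ Fintype.card F - C x = (X - C x) ^ Fintype.card F := by
  obtain ⟨p, hp⟩ := CharP.exists F
  have := hp
  obtain ⟨n, hpp, hn⟩ := FiniteField.card F p
  have : Fact p.Prime := ⟨hpp⟩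
  have : ExpChar F p := ExpChar.prime hpp
  have h1 : C x = (C x) ^ Fintype.card F := by rw [← C_pow, FiniteField.pow_card]
  conv_lhs => rw [h1]
  rw [hn, sub_pow_expChar_pow]

lemma r_congr (h k : F[X]) : h - k ∣ S.r h - S.r k := by
  have : ∀ i : ℕ, h - k ∣ h ^ i - k ^ i := fun i => sub_dvd_pow_sub_pow h k i
  obtain ⟨w2, h2⟩ := this 2
  obtain ⟨w3, h3⟩ := this 3
  obtain ⟨w4, h4⟩ := this 4
  refine ⟨S.D ^ 3 * (S.a0 * S.C1 + S.a1) + S.D ^ 2 * (S.a0 * S.C2 + S.a1 * S.C1 + S.a2) * w2 +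
    S.D * (S.a0 * S.C3 + S.a1 * S.C2 + S.a2 * S.C1) * w3 +
    (S.a0 * S.C4 + S.a1 * S.C3 + S.a2 * S.C2) * w4, ?_⟩
  unfold r
  linear_combination S.D ^ 2 * (S.a0 * S.C2 + S.a1 * S.C1 + S.a2) * h2 +
    S.D * (S.a0 * S.C3 + S.a1 * S.C2 + S.a2 * S.C1) * h3 +
    (S.a0 * S.C4 + S.a1 * S.C3 + S.a2 * S.C2) * h4

lemma s_congr (h k : F[X]) : h - k ∣ S.s h - S.s k :=
  ⟨S.D ^ 2 * S.a1 + S.D * S.a2 * (h + k), by unfold s; ring⟩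

lemma aux_congr (x : F) : (X - C x) ^ Fintype.card F ∣
    S.aux - (S.r (C x - X) + S.s (C x - X) * S.D ^ ((Fintype.card F + 1) / 2)) := by
  have h1 := S.r_congr (X ^ Fintype.card F - X) (C x - X)
  have h2 := S.s_congr (X ^ Fintype.card F - X) (C x - X)
  have h3 : (X : F[X]) ^ Fintype.card F - X - (C x - X) = (X - C x) ^ Fintype.card F := by
    rw [← X_pow_card_sub]; ring
  rw [h3] at h1 h2
  have := dvd_add h1 (Dvd.dvd.mul_right h2 (S.D ^ ((Fintype.card F + 1) / 2)))
  unfold aux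
  convert this using 1
  ring

lemma val_eq (x : F) : S.val (C x - X) = C (S.D.eval x) := (S.taylor x).symm

lemma D_pow_congr (hodd : Odd (Fintype.card F)) (x : F) : (X - C x) ^ Fintype.card F ∣
    (S.D ^ ((Fintype.card F + 1) / 2)) ^ 2 - S.D * C (S.D.eval x) := by
  obtain ⟨m, hm⟩ := hodd
  have h1 : (Fintype.card F + 1) / 2 * 2 = Fintype.card F + 1 := by omega
  rw [← pow_mul, h1, pow_succ', ← mul_sub, ← X_pow_card_sub, ← FiniteField.expand_card S.D,
    expand_eq_sum]
  apply Dvd.dvd.mul_left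
  have := Polynomial.sub_dvd_eval_sub (X ^ Fintype.card F) (C x) (S.D.map C)
  have h2 : eval (C x) (S.D.map C) = C (S.D.eval x) := by
    rw [eval_map, eval₂_at_apply]
  rw [h2, eval_map, eval₂_eq_sum] at this
  exact this

lemma dvd_cancel {x : F} {p t : F[X]} {ℓ : ℕ} (hp : p.eval x ≠ 0)
    (h : (X - C x) ^ ℓ ∣ p * t) : (X - C x) ^ ℓ ∣ t := by
  have hcop : IsCoprime ((X - C x) ^ ℓ) p := by
    apply IsCoprime.pow_left
    rw [(irreducible_X_sub_C x).coprime_iff_not_dvd, dvd_iff_isRoot]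
    exact hp
  exact hcop.dvd_of_dvd_mul_left h

lemma neg_pow_dvd {x : F} {t : F[X]} {ℓ : ℕ} :
    (C x - X) ^ ℓ ∣ t ↔ (X - C x) ^ ℓ ∣ t := by
  rw [← neg_sub X (C x), neg_pow]
  have : IsUnit ((-1 : F[X]) ^ ℓ) := (isUnit_one.neg).pow ℓ
  exact this.mul_left_dvd

lemma Order.le {S : StepanovData F} {ℓ : ℕ} (hl : S.Order ℓ) : ℓ ≤ 7 := by
  rcases hl with rfl | ⟨rfl, -⟩ <;> norm_num

lemma aux_dvd_of_nonsquare (hodd : Odd (Fintype.card F)) (hq : 7 ≤ Fintype.card F) {ℓ : ℕ}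
    (hl : S.Order ℓ) {x : F} (hx : S.D.eval x ^ (Fintype.card F / 2) = -1) :
    (X - C x) ^ ℓ ∣ S.aux := by
  have h2 : (2 : F) ≠ 0 := Ring.two_ne_zero (by
    intro h
    rw [FiniteField.even_card_iff_char_two] at h
    obtain ⟨m, hm⟩ := hodd
    omega)
  have hD : S.D.eval x ≠ 0 := by
    intro h
    rw [h, zero_pow (by omega)] at hx
    have : (1 : F) = 0 := by linear_combination hx
    exact one_ne_zero this
  set E := S.D ^ ((Fintype.card F + 1) / 2) with hE
  have hEx : E.eval x = - S.D.eval x := by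
    have : (Fintype.card F + 1) / 2 = Fintype.card F / 2 + 1 := by
      obtain ⟨m, hm⟩ := hodd; omega
    rw [hE, this, pow_succ, eval_mul, eval_pow, hx]; ring
  have h7 : (X - C x) ^ 7 ∣ (S.D ^ 5 * E - S.root (C x - X)) * (S.D ^ 5 * E + S.root (C x - X)) := by
    have i1 := (pow_dvd_pow (X - C x) hq).trans (S.D_pow_congr hodd x)
    have i2 := neg_pow_dvd.1 (S.root_sq (C x - X))
    rw [val_eq] at i2
    have := dvd_add (Dvd.dvd.mul_left i1 (S.D ^ 10)) i2
    convert this using 1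
    ring
  have h7' := dvd_cancel (by
    simp only [root, eval_sub, eval_mul, eval_pow, eval_add, hEx, eval_C, eval_X, sub_self]
    have : (S.D.eval x ^ 5 * -S.D.eval x - (S.D.eval x ^ 6)) = - (2 * S.D.eval x ^ 6) := by ring
    have h3 : - (2 * S.D.eval x ^ 6) ≠ 0 := neg_ne_zero.2 (mul_ne_zero h2 (pow_ne_zero _ hD))
    rw [← this] at h3
    convert h3 using 2
    ring) h7
  have hl7 := hl.le
  have i1 := (pow_dvd_pow (X - C x) hl7).trans h7'
  have i2 := (pow_dvd_pow (X - C x) (hl7.trans hq)).trans (S.aux_congr x)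
  have i3 := neg_pow_dvd.1 (S.pade (C x - X) hl)
  refine dvd_cancel (p := S.D ^ 5) (by simpa using pow_ne_zero 5 hD) ?_
  have := dvd_add (dvd_add (Dvd.dvd.mul_left i2 (S.D ^ 5)) i3)
    (Dvd.dvd.mul_left i1 (S.s (C x - X)))
  convert this using 1
  ring

lemma aux_dvd_of_root (hq : 7 ≤ Fintype.card F) {ℓ : ℕ}
    (hl : S.Order ℓ) {x : F} (hx : S.D.eval x = 0) :
    (X - C x) ^ (ℓ - 3) ∣ S.aux := by
  have hl7 := hl.le
  have i1 := neg_pow_dvd.1 (S.r_sq (C x - X) hl)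
  rw [val_eq, hx, C_0, mul_zero, sub_zero] at i1
  have hr : (X - C x) ^ (ℓ - 3) ∣ S.r (C x - X) := by
    by_cases h0 : S.r (C x - X) = 0
    · rw [h0]; exact dvd_zero _
    have h1 := (le_rootMultiplicity_iff (pow_ne_zero 2 h0)).2 i1
    rw [pow_two, rootMultiplicity_mul (mul_self_ne_zero.2 h0)] at h1
    rw [← le_rootMultiplicity_iff h0]
    rcases hl with rfl | ⟨rfl, -⟩ <;> omega
  have hE : (X - C x) ^ (ℓ - 3) ∣ S.D ^ ((Fintype.card F + 1) / 2) := by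
    have : (X - C x) ∣ S.D := dvd_iff_isRoot.2 hx
    exact (pow_dvd_pow _ (by omega)).trans (pow_dvd_pow_of_dvd this _)
  have i2 := (pow_dvd_pow (X - C x) (show ℓ - 3 ≤ _ by omega)).trans (S.aux_congr x)
  rw [← dvd_sub_left (dvd_add hr (Dvd.dvd.mul_left hE _))] 
  exact i2

/-- The divisibilities turn into a bound for the number of nonsquare values. -/
lemma card_le [DecidableEq F] (hodd : Odd (Fintype.card F)) (hq : 7 ≤ Fintype.card F) {ℓ N : ℕ}
    (hl : S.Order ℓ) (hne : S.aux ≠ 0) (hN : S.aux.natDegree ≤ N) :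
    ℓ * (Finset.univ.filter fun x => S.D.eval x ^ (Fintype.card F / 2) = -1).card +
      (ℓ - 3) * (Finset.univ.filter fun x => S.D.eval x = 0).card ≤ N := by
  classical
  have hdis : Disjoint (Finset.univ.filter fun x => S.D.eval x ^ (Fintype.card F / 2) = -1)
      (Finset.univ.filter fun x => S.D.eval x = 0) := by
    rw [Finset.disjoint_filter]
    intro x _ h1 h2
    rw [h2, zero_pow (by omega)] at h1
    have : (1 : F) = 0 := by linear_combination h1
    exact one_ne_zero this
  have h1 : ∑ x, S.aux.roots.count x = Multiset.card S.aux.roots :=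
    Multiset.sum_count_eq_card (fun a _ => Finset.mem_univ a)
  refine le_trans ?_ ((S.aux.card_roots').trans hN)
  rw [← h1]
  refine le_trans ?_ (Finset.sum_le_sum_of_subset (Finset.subset_univ
    ((Finset.univ.filter fun x => S.D.eval x ^ (Fintype.card F / 2) = -1) ∪
      (Finset.univ.filter fun x => S.D.eval x = 0))))
  rw [Finset.sum_union hdis]
  apply Nat.add_le_add
  · rw [mul_comm, ← smul_eq_mul]
    apply Finset.card_nsmul_le_sum
    intro x hx
    rw [count_roots, le_rootMultiplicity_iff hne]
    exact S.aux_dvd_of_nonsquare hodd hq hl (Finset.mem_filter.1 hx).2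
  · rw [mul_comm, ← smul_eq_mul]
    apply Finset.card_nsmul_le_sum
    intro x hx
    rw [count_roots, le_rootMultiplicity_iff hne]
    exact S.aux_dvd_of_root hq hl (Finset.mem_filter.1 hx).2

/-- The auxiliary polynomial does not vanish unless `D` is a constant times a square. -/
lemma aux_ne_zero (hodd : Odd (Fintype.card F)) (hq : 121 ≤ Fintype.card F)
    (hD : S.D ≠ 0) (hdeg : S.D.natDegree ≤ 6)
    (hr : ∀ x : F, (S.r (C x - X)).natDegree ≤ 44) (hs : ∀ x : F, (S.s (C x - X)).natDegree ≤ 38)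
    (hsq : ∀ (κ : F) (w : F[X]), κ ≠ 0 → C κ * S.D ≠ w ^ 2) : S.aux ≠ 0 := by
  classical
  intro h0
  -- a good base point
  obtain ⟨x, hxD, hxs⟩ : ∃ x : F, S.D.eval x ≠ 0 ∧ S.s (C x - X) ≠ 0 := by
    set t : F[X][X] := C (S.D ^ 3 * S.a0) + C (S.D ^ 2 * S.a1) * X + C (S.D * S.a2) * X ^ 2 with ht
    have hts : ∀ h, t.eval h = S.s h := by
      intro h; simp [ht, s]
    have htne : t ≠ 0 := by
      intro h
      have c0 : t.coeff 0 = S.D ^ 3 * S.a0 := by simp [ht, coeff_C, coeff_X, -map_mul, -map_pow]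
      have c1 : t.coeff 1 = S.D ^ 2 * S.a1 := by simp [ht, coeff_C, coeff_X_pow, -map_mul, -map_pow]
      have c2 : t.coeff 2 = S.D * S.a2 := by simp [ht, coeff_X_pow, -map_mul, -map_pow]
      rw [h, coeff_zero] at c0 c1 c2
      rcases S.ne with h' | h' | h'
      · exact mul_ne_zero (pow_ne_zero 3 hD) h' c0.symm
      · exact mul_ne_zero (pow_ne_zero 2 hD) h' c1.symm
      · exact mul_ne_zero hD h' c2.symm
    have htd : t.natDegree ≤ 2 := by rw [ht]; compute_degree
    by_contra hcon
    push Not at hcon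
    have hsub : (Finset.univ : Finset F) ⊆ S.D.roots.toFinset ∪
        (t.roots.toFinset.image fun p => p.coeff 0) := by
      intro x _
      by_cases hx : S.D.eval x = 0
      · exact Finset.mem_union_left _ (by simpa [hD] using hx)
      · refine Finset.mem_union_right _ (Finset.mem_image.2 ⟨C x - X, ?_, by simp⟩)
        simp only [Multiset.mem_toFinset, mem_roots htne, IsRoot.def, hts]
        exact hcon x hx
    have := Finset.card_le_card hsub
    have h3 := (Finset.card_union_le S.D.roots.toFinset (t.roots.toFinset.image fun p => p.coeff 0))
    have h4 := (Finset.card_image_le (s := t.roots.toFinset) (f := fun p => p.coeff 0))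
    have h5 := t.roots.toFinset_card_le
    have h6 := S.D.roots.toFinset_card_le
    have h7 := t.card_roots'
    have h8 := S.D.card_roots'
    rw [Finset.card_univ] at this
    omega
  have i1 := S.aux_congr x
  have i2 := S.D_pow_congr hodd x
  rw [h0, zero_sub, dvd_neg] at i1
  set r := S.r (C x - X) with hr'
  set s := S.s (C x - X) with hs'
  have i3 : (X - C x) ^ Fintype.card F ∣ r ^ 2 - s ^ 2 * (S.D * C (S.D.eval x)) := by
    have := dvd_add (Dvd.dvd.mul_right i1 (r - s * S.D ^ ((Fintype.card F + 1) / 2)))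
      (Dvd.dvd.mul_left i2 (s ^ 2))
    convert this using 1
    ring
  have i4 : r ^ 2 - s ^ 2 * (S.D * C (S.D.eval x)) = 0 := by
    refine eq_zero_of_dvd_of_natDegree_lt i3 ?_
    rw [natDegree_pow, natDegree_X_sub_C, mul_one]
    have hr2 := natDegree_pow_le_of_le 2 (hr x)
    have hs2 := natDegree_pow_le_of_le 2 (hs x)
    have hd2 : (S.D * C (S.D.eval x)).natDegree ≤ 6 + 0 :=
      natDegree_mul_le_of_le hdeg (natDegree_C _).le
    have := natDegree_sub_le_of_le hr2 (natDegree_mul_le_of_le hs2 hd2)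
    refine lt_of_le_of_lt this ?_
    norm_num
    omega
  have i5 : s ^ 2 ∣ r ^ 2 := ⟨_, sub_eq_zero.1 i4⟩
  rw [IsIntegrallyClosed.pow_dvd_pow_iff (by norm_num)] at i5
  obtain ⟨w, hw⟩ := i5
  refine hsq (S.D.eval x) w hxD ?_
  have : s ^ 2 * (w ^ 2) = s ^ 2 * (S.D * C (S.D.eval x)) := by
    rw [← sub_eq_zero.1 i4, hw]; ring
  have := mul_left_cancel₀ (pow_ne_zero 2 hxs) this
  rw [this, mul_comm]

end StepanovData

lemma natDegree_add_le' {F : Type} [Field F] {p q : F[X]} {n : ℕ} (hp : p.natDegree ≤ n)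
    (hq : q.natDegree ≤ n) : (p + q).natDegree ≤ n :=
  (natDegree_add_le_of_le hp hq).trans (max_self n).le

lemma natDegree_mul_le' {F : Type} [Field F] {p q : F[X]} {m n k : ℕ} (hp : p.natDegree ≤ m)
    (hq : q.natDegree ≤ n) (hk : m + n ≤ k) : (p * q).natDegree ≤ k :=
  (natDegree_mul_le_of_le hp hq).trans hk

lemma natDegree_half_le {F : Type} [Field F] {p : F[X]} {n : ℕ} (hp : p.natDegree ≤ n) :
    (C (1 / 2 : F) * p).natDegree ≤ n :=
  (natDegree_C_mul_le _ _).trans hp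

/-- Taylor coefficients of the square root, with degree bounds. -/
lemma exists_sqrt_coeffs {F : Type} [Field F] (h2 : (2 : F) ≠ 0) {g : ℕ} (B1 B2 B3 B4 B5 B6 : F[X])
    (h1 : B1.natDegree ≤ g) (hB2 : B2.natDegree ≤ 2 * g) (h3 : B3.natDegree ≤ 3 * g)
    (h4 : B4.natDegree ≤ 4 * g) (h5 : B5.natDegree ≤ 5 * g) (h6 : B6.natDegree ≤ 6 * g) :
    ∃ C1 C2 C3 C4 C5 C6 : F[X], 2 * C1 = B1 ∧ 2 * C2 + C1 ^ 2 = B2 ∧ 2 * C3 + 2 * C1 * C2 = B3 ∧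
      2 * C4 + 2 * C1 * C3 + C2 ^ 2 = B4 ∧ 2 * C5 + 2 * C1 * C4 + 2 * C2 * C3 = B5 ∧
      2 * C6 + 2 * C1 * C5 + 2 * C2 * C4 + C3 ^ 2 = B6 ∧
      C1.natDegree ≤ g ∧ C2.natDegree ≤ 2 * g ∧ C3.natDegree ≤ 3 * g ∧ C4.natDegree ≤ 4 * g ∧
      C5.natDegree ≤ 5 * g ∧ C6.natDegree ≤ 6 * g := by
  have half : ∀ p : F[X], 2 * (C (1 / 2 : F) * p) = p := by
    intro p
    have : (2 : F[X]) = C 2 := rfl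
    rw [this, ← mul_assoc, ← C_mul, mul_one_div_cancel h2, C_1, one_mul]
  have two : ∀ {p q : F[X]} {m n k : ℕ}, p.natDegree ≤ m → q.natDegree ≤ n → m + n = k →
      (2 * p * q).natDegree ≤ k := by
    intro p q m n k hp hq hk
    have : (2 : F[X]) = C 2 := rfl
    rw [this, ← hk]
    exact natDegree_mul_le_of_le ((natDegree_C_mul_le _ _).trans hp) hq
  have sq : ∀ {p : F[X]} {m k : ℕ}, p.natDegree ≤ m → 2 * m = k → (p ^ 2).natDegree ≤ k := by
    intro p m k hp hk
    rw [← hk]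
    exact natDegree_pow_le_of_le 2 hp
  have sub : ∀ {p q : F[X]} {n : ℕ}, p.natDegree ≤ n → q.natDegree ≤ n → (p - q).natDegree ≤ n :=
    fun hp hq => (natDegree_sub_le_of_le hp hq).trans (max_self _).le
  obtain ⟨C1, e1, d1⟩ : ∃ p : F[X], 2 * p = B1 ∧ p.natDegree ≤ g :=
    ⟨_, half _, natDegree_half_le h1⟩
  obtain ⟨C2, e2, d2⟩ : ∃ p : F[X], 2 * p = B2 - C1 ^ 2 ∧ p.natDegree ≤ 2 * g :=
    ⟨_, half _, natDegree_half_le (sub hB2 (sq d1 rfl))⟩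
  obtain ⟨C3, e3, d3⟩ : ∃ p : F[X], 2 * p = B3 - 2 * C1 * C2 ∧ p.natDegree ≤ 3 * g :=
    ⟨_, half _, natDegree_half_le (sub h3 (two d1 d2 (by ring)))⟩
  obtain ⟨C4, e4, d4⟩ : ∃ p : F[X], 2 * p = B4 - 2 * C1 * C3 - C2 ^ 2 ∧ p.natDegree ≤ 4 * g :=
    ⟨_, half _, natDegree_half_le (sub (sub h4 (two d1 d3 (by ring))) (sq d2 (by ring)))⟩
  obtain ⟨C5, e5, d5⟩ : ∃ p : F[X], 2 * p = B5 - 2 * C1 * C4 - 2 * C2 * C3 ∧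
      p.natDegree ≤ 5 * g :=
    ⟨_, half _, natDegree_half_le (sub (sub h5 (two d1 d4 (by ring))) (two d2 d3 (by ring)))⟩
  obtain ⟨C6, e6, d6⟩ : ∃ p : F[X], 2 * p = B6 - 2 * C1 * C5 - 2 * C2 * C4 - C3 ^ 2 ∧
      p.natDegree ≤ 6 * g :=
    ⟨_, half _, natDegree_half_le (sub (sub (sub h6 (two d1 d5 (by ring))) (two d2 d4 (by ring)))
      (sq d3 (by ring)))⟩
  refine ⟨C1, C2, C3, C4, C5, C6, e1, ?_, ?_, ?_, ?_, ?_, d1, d2, d3, d4, d5, d6⟩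
  · rw [e2]; ring
  · rw [e3]; ring
  · rw [e4]; ring
  · rw [e5]; ring
  · rw [e6]; ring

namespace StepanovData

variable {F : Type} [Field F] (S : StepanovData F)

lemma natDegree_term_le {D t h : F[X]} {δ τ H N i j : ℕ} (hD : D.natDegree ≤ δ)
    (ht : t.natDegree ≤ τ) (hh : h.natDegree ≤ H) (hN : i * δ + τ + j * H ≤ N) :
    (D ^ i * t * h ^ j).natDegree ≤ N :=
  (natDegree_mul_le_of_le (natDegree_mul_le_of_le (natDegree_pow_le_of_le i hD) ht)
    (natDegree_pow_le_of_le j hh)).trans hN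

lemma natDegree_r_le {h : F[X]} {δ t0 t1 t2 t3 t4 H N : ℕ} (hD : S.D.natDegree ≤ δ)
    (hh : h.natDegree ≤ H) (h0 : S.a0.natDegree ≤ t0)
    (h1 : (S.a0 * S.C1 + S.a1).natDegree ≤ t1)
    (h2 : (S.a0 * S.C2 + S.a1 * S.C1 + S.a2).natDegree ≤ t2)
    (h3 : (S.a0 * S.C3 + S.a1 * S.C2 + S.a2 * S.C1).natDegree ≤ t3)
    (h4 : (S.a0 * S.C4 + S.a1 * S.C3 + S.a2 * S.C2).natDegree ≤ t4)
    (hN : 4 * δ + t0 ≤ N ∧ 3 * δ + t1 + H ≤ N ∧ 2 * δ + t2 + 2 * H ≤ N ∧ δ + t3 + 3 * H ≤ N ∧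
      t4 + 4 * H ≤ N) : (S.r h).natDegree ≤ N := by
  obtain ⟨n0, n1, n2, n3, n4⟩ := hN
  have e : S.r h = S.D ^ 4 * S.a0 * h ^ 0 + S.D ^ 3 * (S.a0 * S.C1 + S.a1) * h ^ 1 +
    S.D ^ 2 * (S.a0 * S.C2 + S.a1 * S.C1 + S.a2) * h ^ 2 +
    S.D ^ 1 * (S.a0 * S.C3 + S.a1 * S.C2 + S.a2 * S.C1) * h ^ 3 +
    S.D ^ 0 * (S.a0 * S.C4 + S.a1 * S.C3 + S.a2 * S.C2) * h ^ 4 := by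
    unfold r; ring
  rw [e]
  refine natDegree_add_le' (natDegree_add_le' (natDegree_add_le' (natDegree_add_le' ?_ ?_) ?_) ?_) ?_
  · exact natDegree_term_le hD h0 hh (by omega)
  · exact natDegree_term_le hD h1 hh (by omega)
  · exact natDegree_term_le hD h2 hh (by omega)
  · exact natDegree_term_le hD h3 hh (by omega)
  · exact natDegree_term_le hD h4 hh (by omega)

lemma natDegree_s_le {h : F[X]} {δ t0 t1 t2 H N : ℕ} (hD : S.D.natDegree ≤ δ)
    (hh : h.natDegree ≤ H) (h0 : S.a0.natDegree ≤ t0) (h1 : S.a1.natDegree ≤ t1)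
    (h2 : S.a2.natDegree ≤ t2)
    (hN : 3 * δ + t0 ≤ N ∧ 2 * δ + t1 + H ≤ N ∧ (S.a2 = 0 ∨ δ + t2 + 2 * H ≤ N)) :
    (S.s h).natDegree ≤ N := by
  obtain ⟨n0, n1, n2⟩ := hN
  have e : S.s h = S.D ^ 3 * S.a0 * h ^ 0 + S.D ^ 2 * S.a1 * h ^ 1 + S.D ^ 1 * S.a2 * h ^ 2 := by
    unfold s; ring
  rw [e]
  refine natDegree_add_le' (natDegree_add_le' ?_ ?_) ?_
  · exact natDegree_term_le hD h0 hh (by omega)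
  · exact natDegree_term_le hD h1 hh (by omega)
  · rcases n2 with n2 | n2
    · rw [n2, mul_zero, zero_mul, natDegree_zero]; exact Nat.zero_le _
    · exact natDegree_term_le hD h2 hh (by omega)

lemma natDegree_X_pow_card_sub_le {q : ℕ} (hq : 1 ≤ q) :
    ((X : F[X]) ^ q - X).natDegree ≤ q :=
  (natDegree_sub_le_of_le (natDegree_X_pow_le q) natDegree_X_le).trans (by omega)

lemma natDegree_C_sub_X_le (x : F) : (C x - X : F[X]).natDegree ≤ 1 :=
  (natDegree_sub_le_of_le (natDegree_C x).le natDegree_X_le).trans (by omega)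

lemma natDegree_aux_le [Fintype F] {δ N M : ℕ} (hD : S.D.natDegree ≤ δ)
    (hr : (S.r (X ^ Fintype.card F - X)).natDegree ≤ N)
    (hs : (S.s (X ^ Fintype.card F - X)).natDegree ≤ M)
    (hN : M + (Fintype.card F + 1) / 2 * δ ≤ N) : S.aux.natDegree ≤ N :=
  natDegree_add_le' hr ((natDegree_mul_le_of_le hs (natDegree_pow_le_of_le _ hD)).trans hN)

end StepanovData

lemma two_ne_zero_of_odd (hodd : Odd (Fintype.card F)) : (2 : F) ≠ 0 := Ring.two_ne_zero (by
    intro h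
    rw [FiniteField.even_card_iff_char_two] at h
    obtain ⟨m, hm⟩ := hodd
    omega)

/-- Stepanov's bound for the nonsquare values of a polynomial of degree at most six. -/
theorem sextic_bound (hq : 121 ≤ Fintype.card F) (hodd : Odd (Fintype.card F))
    (d0 d1 d2 d3 d4 d5 d6 : F)
    (hsq : ∀ (κ : F) (w : F[X]), κ ≠ 0 → C κ * (C d0 + C d1 * X + C d2 * X ^ 2 + C d3 * X ^ 3 +
      C d4 * X ^ 4 + C d5 * X ^ 5 + C d6 * X ^ 6) ≠ w ^ 2) :
    6 * (Finset.univ.filter fun x : F => (d0 + d1 * x + d2 * x ^ 2 + d3 * x ^ 3 +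
      d4 * x ^ 4 + d5 * x ^ 5 + d6 * x ^ 6) ^ (Fintype.card F / 2) = -1).card +
    3 * (Finset.univ.filter fun x : F => d0 + d1 * x + d2 * x ^ 2 + d3 * x ^ 3 +
      d4 * x ^ 4 + d5 * x ^ 5 + d6 * x ^ 6 = 0).card ≤ 4 * Fintype.card F + 40 := by
  have h2 := two_ne_zero_of_odd hodd
  obtain ⟨D, hD⟩ : ∃ D, D = C d0 + C d1 * X + C d2 * X ^ 2 + C d3 * X ^ 3 +
      C d4 * X ^ 4 + C d5 * X ^ 5 + C d6 * X ^ 6 := ⟨_, rfl⟩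
  obtain ⟨D1, hD1⟩ : ∃ D, D = C d1 + C (2 * d2) * X + C (3 * d3) * X ^ 2 + C (4 * d4) * X ^ 3 +
      C (5 * d5) * X ^ 4 + C (6 * d6) * X ^ 5 := ⟨_, rfl⟩
  obtain ⟨D2, hD2⟩ : ∃ D, D = C d2 + C (3 * d3) * X + C (6 * d4) * X ^ 2 + C (10 * d5) * X ^ 3 +
      C (15 * d6) * X ^ 4 := ⟨_, rfl⟩
  obtain ⟨D3, hD3⟩ : ∃ D, D = C d3 + C (4 * d4) * X + C (10 * d5) * X ^ 2 + C (20 * d6) * X ^ 3 :=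
    ⟨_, rfl⟩
  obtain ⟨D4, hD4⟩ : ∃ D, D = C d4 + C (5 * d5) * X + C (15 * d6) * X ^ 2 := ⟨_, rfl⟩
  obtain ⟨D5, hD5⟩ : ∃ D, D = C d5 + C (6 * d6) * X := ⟨_, rfl⟩
  have nD : D.natDegree ≤ 6 := by rw [hD]; compute_degree
  have nD1 : D1.natDegree ≤ 5 := by rw [hD1]; compute_degree
  have nD2 : D2.natDegree ≤ 4 := by rw [hD2]; compute_degree
  have nD3 : D3.natDegree ≤ 3 := by rw [hD3]; compute_degree
  have nD4 : D4.natDegree ≤ 2 := by rw [hD4]; compute_degree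
  have nD5 : D5.natDegree ≤ 1 := by rw [hD5]; compute_degree
  have taylor : ∀ x : F, C (D.eval x) = D + D1 * (C x - X) + D2 * (C x - X) ^ 2 +
      D3 * (C x - X) ^ 3 + D4 * (C x - X) ^ 4 + D5 * (C x - X) ^ 5 + C d6 * (C x - X) ^ 6 := by
    intro x
    have e : C (D.eval x) = C d0 + C d1 * C x + C d2 * C x ^ 2 + C d3 * C x ^ 3 +
      C d4 * C x ^ 4 + C d5 * C x ^ 5 + C d6 * C x ^ 6 := by
      simp [hD]
    rw [e, hD, hD1, hD2, hD3, hD4, hD5]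
    simp only [map_mul, map_ofNat]
    ring
  obtain ⟨C1, C2, C3, C4, C5, C6, e1, e2, e3, e4, e5, e6, n1, n2, n3, n4, n5, n6⟩ :=
    exists_sqrt_coeffs (g := 5) h2 D1 (D2 * D) (D3 * D ^ 2) (D4 * D ^ 3) (D5 * D ^ 4)
      (C d6 * D ^ 5) nD1 (natDegree_mul_le' nD2 nD (by norm_num))
      (natDegree_mul_le' nD3 (natDegree_pow_le_of_le 2 nD) (by norm_num))
      (natDegree_mul_le' nD4 (natDegree_pow_le_of_le 3 nD) (by norm_num))
      (natDegree_mul_le' nD5 (natDegree_pow_le_of_le 4 nD) (by norm_num))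
      (natDegree_mul_le' (natDegree_C d6).le (natDegree_pow_le_of_le 5 nD) (by norm_num))
  obtain ⟨a0, a1, hpade, hne, na0, na1⟩ : ∃ a0 a1 : F[X], a0 * C5 + a1 * C4 + 0 * C3 = 0 ∧
      (a0 ≠ 0 ∨ a1 ≠ 0 ∨ (0 : F[X]) ≠ 0) ∧ a0.natDegree ≤ 20 ∧ a1.natDegree ≤ 25 := by
    by_cases h45 : C4 = 0 ∧ C5 = 0
    · exact ⟨1, 0, by simp [h45.2], Or.inl one_ne_zero, by simp, by simp⟩
    · refine ⟨C4, -C5, by ring, ?_, n4, by simpa using n5⟩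
      by_contra hcon
      push Not at hcon
      exact h45 ⟨hcon.1, neg_eq_zero.1 hcon.2.1⟩
  let S : StepanovData F := ⟨D, D1, D2, D3, D4, D5, C d6, C1, C2, C3, C4, C5, C6, a0, a1, 0,
    taylor, e1, e2, e3, e4, e5, e6, hpade, hne⟩
  have hDne : D ≠ 0 := by
    intro h
    refine hsq 1 0 one_ne_zero ?_
    rw [← hD, h]; simp
  have rb : ∀ (h : F[X]) (H N : ℕ), h.natDegree ≤ H → 1 ≤ H → 40 + 4 * H ≤ N →
      (S.r h).natDegree ≤ N := by
    intro h H N hh h1 hN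
    refine S.natDegree_r_le (δ := 6) (t0 := 20) (t1 := 25) (t2 := 30) (t3 := 35) (t4 := 40)
      nD hh na0 ?_ ?_ ?_ ?_ (by omega)
    · exact natDegree_add_le' (natDegree_mul_le' na0 n1 (by norm_num)) na1
    · exact natDegree_add_le' (natDegree_add_le' (natDegree_mul_le' na0 n2 (by norm_num))
        (natDegree_mul_le' na1 n1 (by norm_num))) (by simp [S])
    · exact natDegree_add_le' (natDegree_add_le' (natDegree_mul_le' na0 n3 (by norm_num))
        (natDegree_mul_le' na1 n2 (by norm_num))) (by simp [S])
    · exact natDegree_add_le' (natDegree_add_le' (natDegree_mul_le' na0 n4 (by norm_num))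
        (natDegree_mul_le' na1 n3 (by norm_num))) (by simp [S])
  have sb : ∀ (h : F[X]) (H N : ℕ), h.natDegree ≤ H → 1 ≤ H → 37 + H ≤ N →
      (S.s h).natDegree ≤ N := by
    intro h H N hh h1 hN
    exact S.natDegree_s_le (t2 := 0) nD hh na0 na1 (by simp [S]) (by simp [S]; omega)
  have hne := S.aux_ne_zero hodd hq hDne nD
    (fun x => rb _ 1 44 (StepanovData.natDegree_C_sub_X_le x) le_rfl le_rfl)
    (fun x => sb _ 1 38 (StepanovData.natDegree_C_sub_X_le x) le_rfl le_rfl)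
    (by intro κ w hκ; have := hsq κ w hκ; rwa [← hD] at this)
  have hX := StepanovData.natDegree_X_pow_card_sub_le (F := F) (q := Fintype.card F) (by omega)
  have := S.card_le hodd (by omega) (Or.inl rfl) hne
    (S.natDegree_aux_le (N := 4 * Fintype.card F + 40) nD (rb _ _ _ hX (by omega) (by omega))
      (sb _ _ _ hX (by omega) le_rfl) (by obtain ⟨m, hm⟩ := hodd; omega))
  simpa [S, hD] using this

/-- Stepanov's bound for the nonsquare values of a cubic with a simple root. -/
theorem cubic_bound (hq : 121 ≤ Fintype.card F) (hodd : Odd (Fintype.card F)) (a b c x₀ : F)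
    (hx₀ : x₀ ^ 3 + a * x₀ ^ 2 + b * x₀ + c = 0) (hx₀' : 3 * x₀ ^ 2 + 2 * a * x₀ + b ≠ 0) :
    7 * (Finset.univ.filter fun x : F =>
      (x ^ 3 + a * x ^ 2 + b * x + c) ^ (Fintype.card F / 2) = -1).card +
    4 * (Finset.univ.filter fun x : F => x ^ 3 + a * x ^ 2 + b * x + c = 0).card
      ≤ 4 * Fintype.card F + 24 := by
  have h2 := two_ne_zero_of_odd hodd
  obtain ⟨D, hD⟩ : ∃ D : F[X], D = X ^ 3 + C a * X ^ 2 + C b * X + C c := ⟨_, rfl⟩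
  obtain ⟨D1, hD1⟩ : ∃ D : F[X], D = 3 * X ^ 2 + C (2 * a) * X + C b := ⟨_, rfl⟩
  obtain ⟨D2, hD2⟩ : ∃ D : F[X], D = 3 * X + C a := ⟨_, rfl⟩
  have nDe : D.natDegree = 3 := by rw [hD]; compute_degree!
  have nD : D.natDegree ≤ 3 := nDe.le
  have nD1 : D1.natDegree ≤ 2 := by rw [hD1]; compute_degree
  have nD2 : D2.natDegree ≤ 1 := by rw [hD2]; compute_degree
  have taylor : ∀ x : F, C (D.eval x) = D + D1 * (C x - X) + D2 * (C x - X) ^ 2 +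
      1 * (C x - X) ^ 3 + 0 * (C x - X) ^ 4 + 0 * (C x - X) ^ 5 + 0 * (C x - X) ^ 6 := by
    intro x
    have e : C (D.eval x) = C x ^ 3 + C a * C x ^ 2 + C b * C x + C c := by
      simp [hD]
    rw [e, hD, hD1, hD2]
    simp only [map_mul, map_ofNat]
    ring
  obtain ⟨C1, C2, C3, C4, C5, C6, e1, e2, e3, e4, e5, e6, n1, n2, n3, n4, n5, n6⟩ :=
    exists_sqrt_coeffs (g := 2) h2 D1 (D2 * D) (1 * D ^ 2) (0 * D ^ 3) (0 * D ^ 4)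
      (0 * D ^ 5) nD1 (natDegree_mul_le' nD2 nD (by norm_num))
      (by rw [one_mul]; exact natDegree_pow_le_of_le 2 nD) (by simp) (by simp) (by simp)
  have hne : C4 ^ 2 - C3 * C5 ≠ 0 ∨ C3 * C6 - C4 * C5 ≠ 0 ∨ C5 ^ 2 - C4 * C6 ≠ 0 := by
    by_contra hcon
    push Not at hcon
    obtain ⟨k0, k1, -⟩ := hcon
    have hDx : D.eval x₀ = 0 := by rw [hD]; simpa using hx₀
    have hD1x : D1.eval x₀ ≠ 0 := by rw [hD1]; simpa using hx₀'
    replace e1 := congrArg (eval x₀) e1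
    replace e2 := congrArg (eval x₀) e2
    replace e3 := congrArg (eval x₀) e3
    replace e4 := congrArg (eval x₀) e4
    replace e5 := congrArg (eval x₀) e5
    replace e6 := congrArg (eval x₀) e6
    replace k0 := congrArg (eval x₀) k0
    replace k1 := congrArg (eval x₀) k1
    have e2' : eval x₀ (2 : F[X]) = 2 := by simp
    simp only [eval_add, eval_sub, eval_mul, eval_pow, hDx, eval_zero, e2', eval_one]
      at e1 e2 e3 e4 e5 e6 k0 k1
    generalize C1.eval x₀ = c1 at *
    generalize C2.eval x₀ = c2 at *
    generalize C3.eval x₀ = c3 at *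
    generalize C4.eval x₀ = c4 at *
    generalize C5.eval x₀ = c5 at *
    generalize C6.eval x₀ = c6 at *
    have hc1 : c1 ≠ 0 := by
      rintro rfl
      exact hD1x (by rw [← e1, mul_zero])
    obtain ⟨t, rfl⟩ : ∃ t, c1 = 2 * t := ⟨c1 / 2, by field_simp⟩
    obtain rfl : c2 = -2 * t ^ 2 := mul_left_cancel₀ h2 (by linear_combination e2)
    obtain rfl : c3 = 4 * t ^ 3 := mul_left_cancel₀ h2 (by linear_combination e3)
    obtain rfl : c4 = -10 * t ^ 4 := mul_left_cancel₀ h2 (by linear_combination e4)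
    obtain rfl : c5 = 28 * t ^ 5 := mul_left_cancel₀ h2 (by linear_combination e5)
    obtain rfl : c6 = -84 * t ^ 6 := mul_left_cancel₀ h2 (by linear_combination e6)
    have h4 : 2 * (2 * t ^ 9) = 0 := by linear_combination (-5 * t) * k0 + k1
    have ht : t ≠ 0 := right_ne_zero_of_mul hc1
    exact mul_ne_zero h2 (mul_ne_zero h2 (pow_ne_zero 9 ht)) h4
  have na0 : (C4 ^ 2 - C3 * C5).natDegree ≤ 16 :=
    (natDegree_sub_le_of_le (natDegree_pow_le_of_le 2 n4) (natDegree_mul_le_of_le n3 n5)).trans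
      (by norm_num)
  have na1 : (C3 * C6 - C4 * C5).natDegree ≤ 18 :=
    (natDegree_sub_le_of_le (natDegree_mul_le_of_le n3 n6) (natDegree_mul_le_of_le n4 n5)).trans
      (by norm_num)
  have na2 : (C5 ^ 2 - C4 * C6).natDegree ≤ 20 :=
    (natDegree_sub_le_of_le (natDegree_pow_le_of_le 2 n5) (natDegree_mul_le_of_le n4 n6)).trans
      (by norm_num)
  let S : StepanovData F := ⟨D, D1, D2, 1, 0, 0, 0, C1, C2, C3, C4, C5, C6, C4 ^ 2 - C3 * C5,
    C3 * C6 - C4 * C5, C5 ^ 2 - C4 * C6, taylor, e1, e2, e3, e4, e5, e6, by ring, hne⟩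
  have rb : ∀ (h : F[X]) (H N : ℕ), h.natDegree ≤ H → 1 ≤ H → 24 + 4 * H ≤ N →
      (S.r h).natDegree ≤ N := by
    intro h H N hh h1 hN
    refine S.natDegree_r_le (δ := 3) (t0 := 16) (t1 := 18) (t2 := 20) (t3 := 22) (t4 := 24)
      nD hh na0 ?_ ?_ ?_ ?_ (by omega)
    · exact natDegree_add_le' (natDegree_mul_le' na0 n1 (by norm_num)) na1
    · exact natDegree_add_le' (natDegree_add_le' (natDegree_mul_le' na0 n2 (by norm_num))
        (natDegree_mul_le' na1 n1 (by norm_num))) na2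
    · exact natDegree_add_le' (natDegree_add_le' (natDegree_mul_le' na0 n3 (by norm_num))
        (natDegree_mul_le' na1 n2 (by norm_num))) (natDegree_mul_le' na2 n1 (by norm_num))
    · exact natDegree_add_le' (natDegree_add_le' (natDegree_mul_le' na0 n4 (by norm_num))
        (natDegree_mul_le' na1 n3 (by norm_num))) (natDegree_mul_le' na2 n2 (by norm_num))
  have sb : ∀ (h : F[X]) (H N : ℕ), h.natDegree ≤ H → 1 ≤ H → 23 + 2 * H ≤ N →
      (S.s h).natDegree ≤ N := by
    intro h H N hh h1 hN
    exact S.natDegree_s_le nD hh na0 na1 na2 (by omega)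
  have hDne : D ≠ 0 := by
    rintro rfl
    rw [natDegree_zero] at nDe
    omega
  have hne := S.aux_ne_zero hodd hq hDne (nD.trans (by norm_num))
    (fun x => rb _ 1 44 (StepanovData.natDegree_C_sub_X_le x) le_rfl (by norm_num))
    (fun x => sb _ 1 38 (StepanovData.natDegree_C_sub_X_le x) le_rfl (by norm_num))
    (by
      intro κ w hκ h
      have := congrArg natDegree h
      rw [natDegree_C_mul hκ, natDegree_pow] at this
      change D.natDegree = _ at this
      omega)
  have hX := StepanovData.natDegree_X_pow_card_sub_le (F := F) (q := Fintype.card F) (by omega)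
  have := S.card_le hodd (by omega) (Or.inr ⟨rfl, by simp only [S]; ring⟩) hne
    (S.natDegree_aux_le (N := 4 * Fintype.card F + 24) nD (rb _ _ _ hX (by omega) (by omega))
      (sb _ _ _ hX (by omega) le_rfl) (by obtain ⟨m, hm⟩ := hodd; omega))
  simpa [S, hD] using this

/-- Coefficient comparison in `κ D = w ^ 2` for `D` of degree at most six. -/
lemma exists_coeffs_of_C_mul_eq_sq {F : Type} [Field F] {κ d0 d1 d2 d3 d4 d5 d6 : F} {w : F[X]}
    (h : C κ * (C d0 + C d1 * X + C d2 * X ^ 2 + C d3 * X ^ 3 + C d4 * X ^ 4 + C d5 * X ^ 5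
      + C d6 * X ^ 6) = w ^ 2) :
    ∃ w0 w1 w2 w3 : F, κ * d0 = w0 ^ 2 ∧ κ * d1 = 2 * w0 * w1 ∧ κ * d2 = w1 ^ 2 + 2 * w0 * w2 ∧
      κ * d3 = 2 * w0 * w3 + 2 * w1 * w2 ∧ κ * d4 = w2 ^ 2 + 2 * w1 * w3 ∧
      κ * d5 = 2 * w2 * w3 ∧ κ * d6 = w3 ^ 2 := by
  have hdeg : w.natDegree < 4 := by
    have h1 : (w ^ 2).natDegree ≤ 6 := by
      rw [← h]
      refine (natDegree_C_mul_le _ _).trans ?_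
      compute_degree
    rw [natDegree_pow] at h1
    omega
  have hw := w.as_sum_range_C_mul_X_pow' hdeg
  simp only [Finset.sum_range_succ, Finset.sum_range_zero, zero_add, pow_zero, mul_one,
    pow_one] at hw
  generalize w.coeff 0 = w0, w.coeff 1 = w1, w.coeff 2 = w2, w.coeff 3 = w3 at hw
  have hsq : w ^ 2 = C (w0 ^ 2) + C (2 * w0 * w1) * X + C (w1 ^ 2 + 2 * w0 * w2) * X ^ 2
      + C (2 * w0 * w3 + 2 * w1 * w2) * X ^ 3 + C (w2 ^ 2 + 2 * w1 * w3) * X ^ 4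
      + C (2 * w2 * w3) * X ^ 5 + C (w3 ^ 2) * X ^ 6 := by
    rw [hw]
    simp only [map_add, map_mul, map_pow, map_ofNat]
    ring
  rw [hsq] at h
  refine ⟨w0, w1, w2, w3, ?_, ?_, ?_, ?_, ?_, ?_, ?_⟩
  · simpa [coeff_X, coeff_X_pow, coeff_C, -map_pow, -map_mul, -map_add]
      using congrArg (coeff · 0) h
  · simpa [coeff_X, coeff_X_pow, coeff_C, -map_pow, -map_mul, -map_add]
      using congrArg (coeff · 1) h
  · simpa [coeff_X, coeff_X_pow, coeff_C, -map_pow, -map_mul, -map_add]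
      using congrArg (coeff · 2) h
  · simpa [coeff_X, coeff_X_pow, coeff_C, -map_pow, -map_mul, -map_add]
      using congrArg (coeff · 3) h
  · simpa [coeff_X, coeff_X_pow, coeff_C, -map_pow, -map_mul, -map_add]
      using congrArg (coeff · 4) h
  · simpa [coeff_X, coeff_X_pow, coeff_C, -map_pow, -map_mul, -map_add]
      using congrArg (coeff · 5) h
  · simpa [coeff_X, coeff_X_pow, coeff_C, -map_pow, -map_mul, -map_add]
      using congrArg (coeff · 6) h

/-- The elimination identity behind `affine_disc_ne_sq`, in the normalisation `c = β η`. -/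
lemma elimination_identity {F : Type} [Field F] {α β η d0 d1 d2 d3 d4 : F}
    (h4 : d4 = β ^ 2 + 4 * α * η ^ 2 - 12 * α * (β * η))
    (h3 : d3 = 8 * α * β * η + 32 * η ^ 3 + 36 * (β * η - η ^ 2) * η)
    (h2 : d2 = 4 * α ^ 2 * η ^ 2 - 2 * α * β ^ 2 - 48 * β * η ^ 2 + 12 * (β * η - η ^ 2) * α ^ 2
      - 18 * (β * η - η ^ 2) * β)
    (h1 : d1 = -4 * α ^ 2 * β * η + 24 * β ^ 2 * η - 36 * (β * η - η ^ 2) * α * η)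
    (h0 : d0 = α ^ 2 * β ^ 2 - 4 * β ^ 3 - 4 * (β * η - η ^ 2) * α ^ 3
      + 18 * (β * η - η ^ 2) * α * β - 27 * (β * η - η ^ 2) ^ 2)
    (p1 : 4 * (d4 - β * η) ^ 2 - 16 * (β * η) * (2 * d3 + (d4 - β * η))
      - 64 * (β * η) * d2 = 0)
    (p2 : 4 * (d4 - β * η) * (2 * d3 + (d4 - β * η)) - 64 * (β * η) * d1 = 0)
    (p3 : (2 * d3 + (d4 - β * η)) ^ 2 - 64 * (β * η) * d0 = 0) :
    65536 * (β ^ 3 * η ^ 3 * (β - η) ^ 3) = 0 := by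
  subst h4 h3 h2 h1 h0
  linear_combination
    (- 17408 * α ^ 4 * β ^ 2 * η + 7168 * α ^ 4 * β * η ^ 2 - 2048 * α ^ 4 * η ^ 3 + 1280 *
      α ^ 3 * β ^ 3 + 90784 * α ^ 3 * β ^ 2 * η ^ 2 - 4224 * α ^ 3 * β ^ 2 * η - 118080 * α
      ^ 3 * β * η ^ 3 - 1664 * α ^ 3 * β * η ^ 2 + 72352 * α ^ 3 * η ^ 4 + 1024 * α ^ 3 * η
      ^ 3 + 65760 * α ^ 2 * β ^ 3 * η + 1504 * α ^ 2 * β ^ 3 - 1228608 * α ^ 2 * β ^ 2 * η ^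
      3 + 108800 * α ^ 2 * β ^ 2 * η ^ 2 + 2208 * α ^ 2 * β ^ 2 * η - 819072 * α ^ 2 * β * η
      ^ 4 - 232864 * α ^ 2 * β * η ^ 3 - 896 * α ^ 2 * β * η ^ 2 - 136512 * α ^ 2 * η ^ 5 +
      94144 * α ^ 2 * η ^ 4 + 768 * α ^ 2 * η ^ 3 - 706 * α * β ^ 4 - 1534608 * α * β ^ 3 *
      η ^ 2 - 42944 * α * β ^ 3 * η - 416 * α * β ^ 3 - 2197344 * α * β ^ 2 * η ^ 3 + 102366
      * α * β ^ 2 * η ^ 2 + 328 * α * β ^ 2 * η - 1139472 * α * β * η ^ 4 - 53556 * α * β *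
      η ^ 3 - 392 * α * β * η ^ 2 - 192512 * α * η ^ 5 - 1832 * α * η ^ 4 - 115256 * β ^ 4 *
      η - 851 * β ^ 4 + 6912 * β ^ 3 * η ^ 3 - 1844880 * β ^ 3 * η ^ 2 - 28064 * β ^ 3 * η -
      50 * β ^ 3 + 6912 * β ^ 2 * η ^ 4 - 443560 * β ^ 2 * η ^ 3 + 1881 * β ^ 2 * η ^ 2 + 50
      * β ^ 2 * η + 2304 * β * η ^ 5 + 54944 * β * η ^ 4 + 474 * β * η ^ 3 + 256 * η ^ 6 +
      592 * η ^ 5) * p1 +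
    (- 3072 * α ^ 4 * β ^ 2 * η + 1024 * α ^ 4 * β * η ^ 2 + 2048 * α ^ 4 * η ^ 3 - 1280 *
      α ^ 3 * β ^ 3 + 204768 * α ^ 3 * β ^ 2 * η ^ 2 + 2688 * α ^ 3 * β ^ 2 * η - 136512 * α
      ^ 3 * β * η ^ 3 - 18816 * α ^ 3 * β * η ^ 2 - 68256 * α ^ 3 * η ^ 4 - 1024 * α ^ 3 * η
      ^ 3 - 1504 * α ^ 2 * β ^ 3 + 214464 * α ^ 2 * β ^ 2 * η ^ 2 + 5856 * α ^ 2 * β ^ 2 * η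
      - 95744 * α ^ 2 * β * η ^ 3 + 2432 * α ^ 2 * β * η ^ 2 - 96192 * α ^ 2 * η ^ 4 + 128 *
      α ^ 2 * η ^ 3 + 706 * α * β ^ 4 - 1225152 * α * β ^ 3 * η ^ 2 - 33884 * α * β ^ 3 * η
      + 192 * α * β ^ 3 - 815616 * α * β ^ 2 * η ^ 3 - 7594 * α * β ^ 2 * η ^ 2 - 1000 * α *
      β ^ 2 * η - 135360 * α * β * η ^ 4 + 163624 * α * β * η ^ 3 + 552 * α * β * η ^ 2 +
      128 * α * η ^ 5 - 3044 * α * η ^ 4 - 102600 * β ^ 4 * η - 1684512 * β ^ 3 * η ^ 2 +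
      17989 * β ^ 3 * η + 66 * β ^ 3 - 1060944 * β ^ 2 * η ^ 3 - 46334 * β ^ 2 * η ^ 2 - 146
      * β ^ 2 * η - 160992 * β * η ^ 4 - 455 * β * η ^ 3 + 3096 * η ^ 5) * p2 +
    (- 12288 * α ^ 3 * β ^ 2 * η + 3072 * α ^ 2 * β ^ 2 * η ^ 2 + 1024 * α ^ 2 * β * η ^ 3
      - 3584 * α ^ 2 * η ^ 3 + 66640 * α * β ^ 3 * η + 896 * α * β ^ 3 + 97936 * α * β ^ 2 *
      η ^ 2 + 256 * α * β ^ 2 * η + 44272 * α * β * η ^ 3 + 2432 * α * β * η ^ 2 + 6192 * α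
      * η ^ 4 + 3404 * β ^ 4 - 4608 * β ^ 3 * η ^ 2 + 43068 * β ^ 3 * η - 64 * β ^ 3 - 3072
      * β ^ 2 * η ^ 3 + 3620 * β ^ 2 * η ^ 2 - 416 * β ^ 2 * η - 512 * β * η ^ 4 - 2732 * β
      * η ^ 3) * p3

lemma affine_disc_ne_sq {F : Type} [Field F] (h2 : (2 : F) ≠ 0) {A B c y : F}
    (he : c - y ^ 2 ≠ 0) (hj : A ^ 2 - 3 * B ≠ 0)
    (hdisc : A ^ 2 * B ^ 2 - 4 * B ^ 3 - 4 * c * A ^ 3 + 18 * c * A * B - 27 * c ^ 2 ≠ 0)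
    {κ : F} (hκ : κ ≠ 0) (w : F[X]) :
    C κ * (C (A ^ 2 * B ^ 2 - 4 * B ^ 3 - 4 * (c - y ^ 2) * A ^ 3 + 18 * (c - y ^ 2) * A * B
        - 27 * (c - y ^ 2) ^ 2)
      + C (-4 * A ^ 2 * B * y + 24 * B ^ 2 * y - 36 * (c - y ^ 2) * A * y) * X
      + C (4 * A ^ 2 * y ^ 2 - 2 * A * B ^ 2 - 48 * B * y ^ 2 + 12 * (c - y ^ 2) * A ^ 2
        - 18 * (c - y ^ 2) * B) * X ^ 2
      + C (8 * A * B * y + 32 * y ^ 3 + 36 * (c - y ^ 2) * y) * X ^ 3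
      + C (B ^ 2 + 4 * A * y ^ 2 - 12 * A * c) * X ^ 4 + C (-4 * B * y) * X ^ 5
      + C (4 * c) * X ^ 6) ≠ w ^ 2 := by
  intro h
  obtain ⟨w0, w1, w2, w3, e0, e1, e2, e3, e4, e5, e6⟩ := exists_coeffs_of_C_mul_eq_sq h
  have h4 : (4 : F) ≠ 0 := by
    rw [show (4 : F) = 2 * 2 by norm_num]; exact mul_ne_zero h2 h2
  by_cases hc : c = 0
  · subst hc
    have hw3 : w3 = 0 := by
      have : w3 ^ 2 = 0 := by rw [← e6]; ring
      exact pow_eq_zero_iff (two_ne_zero) |>.1 this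
    have hy : y ≠ 0 := by rintro rfl; exact he (by ring)
    have hB : B = 0 := by
      have : (κ * 4 * y) * B = 0 := by rw [hw3] at e5; linear_combination -e5
      exact (mul_eq_zero.1 this).resolve_left (mul_ne_zero (mul_ne_zero hκ h4) hy)
    exact hdisc (by rw [hB]; ring)
  -- rescale the square root to have leading coefficient `4 c`
  obtain ⟨k, hk⟩ : ∃ k, B * y = k * c := ⟨B * y / c, by field_simp⟩
  obtain ⟨v0, v1, v2, hv0, hv1, hv2⟩ : ∃ v0 v1 v2, κ * v0 = w0 * w3 ∧ κ * v1 = w1 * w3 ∧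
      κ * v2 = w2 * w3 :=
    ⟨w0 * w3 / κ, w1 * w3 / κ, w2 * w3 / κ, by field_simp, by field_simp, by field_simp⟩
  have hκ2 : κ ^ 2 ≠ 0 := pow_ne_zero 2 hκ
  have f5 : v2 = -2 * (k * c) := by
    apply mul_left_cancel₀ (mul_ne_zero h2 hκ)
    linear_combination 2 * hv2 - e5 - 4 * κ * hk
  have f4 : 2 * v1 = B ^ 2 + 4 * A * y ^ 2 - 12 * A * c - k ^ 2 * c := by
    apply mul_left_cancel₀ (mul_ne_zero hκ2 (mul_ne_zero h4 hc))
    have : (κ * v2) ^ 2 = w2 ^ 2 * (κ * (4 * c)) := by rw [hv2, e6]; ring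
    rw [f5] at this
    linear_combination 8 * κ * c * hv1 - 4 * κ * c * e4 + this
  have f3 : 2 * v0 = 8 * A * B * y + 32 * y ^ 3 + 36 * (c - y ^ 2) * y + k * v1 := by
    apply mul_left_cancel₀ (mul_ne_zero hκ2 (mul_ne_zero h4 hc))
    have : (κ * v2) * (κ * v1) = w2 * w1 * (κ * (4 * c)) := by rw [hv2, hv1, e6]; ring
    rw [f5] at this
    linear_combination 8 * κ * c * hv0 - 4 * κ * c * e3 + 2 * this
  have f2 : v1 ^ 2 - 4 * k * c * v0 = 4 * c * (4 * A ^ 2 * y ^ 2 - 2 * A * B ^ 2 - 48 * B * y ^ 2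
      + 12 * (c - y ^ 2) * A ^ 2 - 18 * (c - y ^ 2) * B) := by
    apply mul_left_cancel₀ hκ2
    have h1 : (κ * v2) * (κ * v0) = w2 * w0 * (κ * (4 * c)) := by rw [hv2, hv0, e6]; ring
    have h2 : (κ * v1) ^ 2 = w1 ^ 2 * (κ * (4 * c)) := by rw [hv1, e6]; ring
    rw [f5] at h1
    linear_combination 2 * h1 + h2 - 4 * c * κ * e2
  have f1 : 2 * v0 * v1 = 4 * c * (-4 * A ^ 2 * B * y + 24 * B ^ 2 * y
      - 36 * (c - y ^ 2) * A * y) := by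
    apply mul_left_cancel₀ hκ2
    have h1 : (κ * v1) * (κ * v0) = w1 * w0 * (κ * (4 * c)) := by rw [hv1, hv0, e6]; ring
    linear_combination 2 * h1 - 4 * c * κ * e1
  have f0 : v0 ^ 2 = 4 * c * (A ^ 2 * B ^ 2 - 4 * B ^ 3 - 4 * (c - y ^ 2) * A ^ 3
      + 18 * (c - y ^ 2) * A * B - 27 * (c - y ^ 2) ^ 2) := by
    apply mul_left_cancel₀ hκ2
    have h1 : (κ * v0) ^ 2 = w0 ^ 2 * (κ * (4 * c)) := by rw [hv0, e6]; ring
    linear_combination h1 - 4 * c * κ * e0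
  by_cases hy : y = 0
  · subst hy
    have hk0 : k = 0 := by
      have : k * c = 0 := by rw [← hk]; ring
      exact (mul_eq_zero.1 this).resolve_right hc
    subst hk0
    have hv00 : v0 = 0 := by
      have : 2 * v0 = 0 := by rw [f3]; ring
      exact (mul_eq_zero.1 this).resolve_left h2
    apply hdisc
    have : (4 * c) * (A ^ 2 * B ^ 2 - 4 * B ^ 3 - 4 * c * A ^ 3 + 18 * c * A * B
        - 27 * c ^ 2) = 0 := by
      rw [hv00] at f0; linear_combination -f0
    exact (mul_eq_zero.1 this).resolve_left (mul_ne_zero h4 hc)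
  by_cases hk0 : k = 0
  · subst hk0
    have hB : B = 0 := by
      have : B * y = 0 := by rw [hk]; ring
      exact (mul_eq_zero.1 this).resolve_right hy
    subst hB
    have hA : A ≠ 0 := by rintro rfl; exact hj (by ring)
    obtain rfl : v1 = 2 * A * (y ^ 2 - 3 * c) := by
      apply mul_left_cancel₀ h2
      linear_combination f4
    obtain rfl : v0 = 2 * y * (9 * c - y ^ 2) := by
      apply mul_left_cancel₀ h2
      linear_combination f3
    have h3c : y ^ 2 + 3 * c = 0 := by
      have : (4 * A ^ 2 * (c - y ^ 2)) * (y ^ 2 + 3 * c) = 0 := by linear_combination -f2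
      exact (mul_eq_zero.1 this).resolve_left
        (mul_ne_zero (mul_ne_zero h4 (pow_ne_zero 2 hA)) he)
    have : (4 * c) ^ 2 * (4 * A ^ 3) = 0 := by
      linear_combination f0 + (16 * A ^ 3 * c - 4 * (y ^ 2 + 3 * c) ^ 2) * h3c
    exact mul_ne_zero (pow_ne_zero 2 (mul_ne_zero h4 hc)) (mul_ne_zero h4 (pow_ne_zero 3 hA)) this
  obtain ⟨α, rfl⟩ : ∃ α, A = k ^ 2 * α := ⟨A / k ^ 2, by field_simp⟩
  obtain ⟨β, rfl⟩ : ∃ β, B = k ^ 4 * β := ⟨B / k ^ 4, by field_simp⟩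
  obtain ⟨η, rfl⟩ : ∃ η, y = k ^ 3 * η := ⟨y / k ^ 3, by field_simp⟩
  obtain rfl : c = k ^ 6 * (β * η) := by
    apply mul_left_cancel₀ hk0
    rw [← hk]; ring
  have key := elimination_identity (α := α) (β := β) (η := η) rfl rfl rfl rfl rfl
    (by apply mul_left_cancel₀ (pow_ne_zero 16 hk0)
        linear_combination 16 * f2 - 4 * (2 * v1
          + (k ^ 8 * (β ^ 2 + 4 * α * η ^ 2 - 12 * α * (β * η) - β * η))) * f4
          + 16 * k * (k ^ 6 * (β * η)) * (2 * f3 + k * f4))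
    (by apply mul_left_cancel₀ (pow_ne_zero 17 hk0)
        linear_combination 16 * f1 - 4 * (4 * v0 * f4
          + (k ^ 8 * (β ^ 2 + 4 * α * η ^ 2 - 12 * α * (β * η) - β * η))
            * (2 * f3 + k * f4)))
    (by apply mul_left_cancel₀ (pow_ne_zero 18 hk0)
        linear_combination 16 * f0 - (4 * v0
          + 2 * (k ^ 9 * (8 * α * β * η + 32 * η ^ 3 + 36 * (β * η - η ^ 2) * η))
          + k * (k ^ 8 * (β ^ 2 + 4 * α * η ^ 2 - 12 * α * (β * η) - β * η)))
            * (2 * f3 + k * f4))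
  have h65536 : (65536 : F) ≠ 0 := by
    rw [show (65536 : F) = 2 ^ 16 by norm_num]; exact pow_ne_zero _ h2
  have hβ : β ≠ 0 := by rintro rfl; exact hc (by ring)
  have hη : η ≠ 0 := by rintro rfl; exact hy (by ring)
  have hβη : β - η ≠ 0 := by
    intro h0
    exact he (by linear_combination k ^ 6 * η * h0)
  exact mul_ne_zero h65536 (mul_ne_zero (mul_ne_zero (pow_ne_zero 3 hβ) (pow_ne_zero 3 hη))
    (pow_ne_zero 3 hβη)) key

/-- The discriminant of the pencil of parallel lines `y = m x + τ` is not a square up to a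
constant; here `p = a - m ^ 2`. -/
lemma parallel_disc_ne_sq {F : Type} [Field F] (h2 : (2 : F) ≠ 0) {a b c m p : F}
    (hp : p = a - m ^ 2) (hj : a ^ 2 - 3 * b ≠ 0)
    (hdisc : a ^ 2 * b ^ 2 - 4 * b ^ 3 - 4 * c * a ^ 3 + 18 * c * a * b - 27 * c ^ 2 ≠ 0)
    {κ : F} (hκ : κ ≠ 0) (w : F[X]) :
    C κ * (C (p ^ 2 * b ^ 2 - 4 * b ^ 3 - 4 * p ^ 3 * c + 18 * p * b * c - 27 * c ^ 2)
      + C (-4 * p ^ 2 * b * m + 24 * b ^ 2 * m - 36 * p * m * c) * X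
      + C (4 * p ^ 2 * m ^ 2 - 48 * b * m ^ 2 + 4 * p ^ 3 - 18 * p * b + 54 * c) * X ^ 2
      + C (32 * m ^ 3 + 36 * p * m) * X ^ 3 + C (-27) * X ^ 4 + C 0 * X ^ 5
      + C 0 * X ^ 6) ≠ w ^ 2 := by
  intro h
  obtain ⟨w0, w1, w2, w3, e0, e1, e2, e3, e4, e5, e6⟩ := exists_coeffs_of_C_mul_eq_sq h
  have h4 : (4 : F) ≠ 0 := by
    rw [show (4 : F) = 2 * 2 by norm_num]; exact mul_ne_zero h2 h2
  obtain rfl : w3 = 0 := by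
    have : w3 ^ 2 = 0 := by rw [← e6]; ring
    exact pow_eq_zero_iff (two_ne_zero) |>.1 this
  obtain rfl : a = p + m ^ 2 := by rw [hp]; ring
  by_cases h3 : (3 : F) = 0
  · obtain rfl : w2 = 0 := by
      have : w2 ^ 2 = 0 := by linear_combination -e4 - 9 * κ * h3
      exact pow_eq_zero_iff (two_ne_zero) |>.1 this
    obtain rfl : m = 0 := by
      have : κ * m ^ 3 = 0 := by linear_combination -e3 + κ * (11 * m ^ 3 + 12 * p * m) * h3
      exact pow_eq_zero_iff (three_ne_zero) |>.1 ((mul_eq_zero.1 this).resolve_left hκ)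
    have hw : w1 ≠ 0 := by
      rintro rfl
      have : κ * 4 * p ^ 3 = 0 := by
        linear_combination e2 + κ * (6 * p * b - 18 * c) * h3
      have hp0 : p = 0 := pow_eq_zero_iff (three_ne_zero) |>.1
        ((mul_eq_zero.1 this).resolve_left (mul_ne_zero hκ h4))
      exact hj (by rw [hp0, h3]; ring)
    obtain rfl : w0 = 0 := by
      have : 2 * w1 * w0 = 0 := by linear_combination -e1
      exact (mul_eq_zero.1 this).resolve_left (mul_ne_zero h2 hw)
    have : κ * (p ^ 2 * b ^ 2 - 4 * b ^ 3 - 4 * p ^ 3 * c + 18 * p * b * c - 27 * c ^ 2) = 0 := by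
      linear_combination e0
    exact hdisc (by linear_combination (mul_eq_zero.1 this).resolve_left hκ)
  have h27 : (27 : F) ≠ 0 := by
    rw [show (27 : F) = 3 ^ 3 by norm_num]; exact pow_ne_zero _ h3
  obtain ⟨v0, v1, hv0, hv1⟩ : ∃ v0 v1, κ * v0 = w0 * w2 ∧ κ * v1 = w1 * w2 :=
    ⟨w0 * w2 / κ, w1 * w2 / κ, by field_simp, by field_simp⟩
  have hκ2 : κ ^ 2 ≠ 0 := pow_ne_zero 2 hκ
  obtain rfl : v1 = 16 * m ^ 3 + 18 * p * m := by
    apply mul_left_cancel₀ (mul_ne_zero h2 hκ)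
    linear_combination 2 * hv1 - e3
  have f2 : 54 * v0 = 27 * (4 * p ^ 2 * m ^ 2 - 48 * b * m ^ 2 + 4 * p ^ 3 - 18 * p * b + 54 * c)
      + (16 * m ^ 3 + 18 * p * m) ^ 2 := by
    apply mul_left_cancel₀ hκ2
    have h1 : (w1 * w2) ^ 2 = w1 ^ 2 * (κ * (-27)) := by rw [e4]; ring
    rw [← hv1] at h1
    linear_combination 54 * κ * hv0 - 27 * κ * e2 - h1
  have f1 : 2 * v0 * (16 * m ^ 3 + 18 * p * m)
      = -27 * (-4 * p ^ 2 * b * m + 24 * b ^ 2 * m - 36 * p * m * c) := by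
    apply mul_left_cancel₀ hκ2
    have h1 : (w0 * w2) * (w1 * w2) = w0 * w1 * (κ * (-27)) := by rw [e4]; ring
    rw [← hv1, ← hv0] at h1
    linear_combination 2 * h1 + 27 * κ * e1
  have f0 : v0 ^ 2 = -27 * (p ^ 2 * b ^ 2 - 4 * b ^ 3 - 4 * p ^ 3 * c + 18 * p * b * c
      - 27 * c ^ 2) := by
    apply mul_left_cancel₀ hκ2
    have h1 : (w0 * w2) ^ 2 = w0 ^ 2 * (κ * (-27)) := by rw [e4]; ring
    rw [← hv0] at h1
    linear_combination h1 + 27 * κ * e0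
  by_cases hm : m = 0
  · subst hm
    have : 2916 * 4 * (p ^ 2 - 3 * b) ^ 3 = 0 := by
      linear_combination 2916 * f0 - (54 * v0 + 27 * (4 * p ^ 3 - 18 * p * b + 54 * c)) * f2
    have h2916 : (2916 : F) ≠ 0 := by
      rw [show (2916 : F) = 4 * 27 * 27 by norm_num]
      exact mul_ne_zero (mul_ne_zero h4 h27) h27
    refine hj ?_
    have := pow_eq_zero_iff (three_ne_zero) |>.1
      ((mul_eq_zero.1 this).resolve_left (mul_ne_zero h2916 h4))
    linear_combination this
  obtain ⟨s, rfl⟩ : ∃ s, p = 3 * s := ⟨p / 3, by field_simp⟩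
  obtain ⟨μ, rfl⟩ : ∃ μ, m = 3 * μ := ⟨m / 3, by field_simp⟩
  have hμ : μ ≠ 0 := by rintro rfl; exact hm (by ring)
  have hlin : 23328 * (3 * μ) ^ 2 * c + (27 * (4 * (3 * s) ^ 2 * (3 * μ) ^ 2 - 48 * b * (3 * μ) ^ 2
      + 4 * (3 * s) ^ 3 - 18 * (3 * s) * b) + (16 * (3 * μ) ^ 3 + 18 * (3 * s) * (3 * μ)) ^ 2)
        * (2 * (8 * (3 * μ) ^ 2 + 9 * (3 * s)))
      + 729 * (-4 * (3 * s) ^ 2 * b + 24 * b ^ 2) = 0 := by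
    apply mul_left_cancel₀ hm
    linear_combination 27 * f1 - (16 * (3 * μ) ^ 3 + 18 * (3 * s) * (3 * μ)) * f2
  have h0 : (27 * (4 * (3 * s) ^ 2 * (3 * μ) ^ 2 - 48 * b * (3 * μ) ^ 2
      + 4 * (3 * s) ^ 3 - 18 * (3 * s) * b + 54 * c)
        + (16 * (3 * μ) ^ 3 + 18 * (3 * s) * (3 * μ)) ^ 2) ^ 2
      + 78732 * ((3 * s) ^ 2 * b ^ 2 - 4 * b ^ 3 - 4 * (3 * s) ^ 3 * c + 18 * (3 * s) * b * c
        - 27 * c ^ 2) = 0 := by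
    rw [← f2]
    linear_combination 2916 * f0
  have hunit : (2985984 * 27 ^ 3 * (3 * μ) ^ 2 : F) ≠ 0 := by
    rw [show (2985984 : F) = 4 ^ 6 * 27 ^ 2 by norm_num]
    exact mul_ne_zero (mul_ne_zero (mul_ne_zero (pow_ne_zero _ h4) (pow_ne_zero _ h27))
      (pow_ne_zero _ h27)) (pow_ne_zero _ hm)
  obtain rfl : b = 3 * s ^ 2 + 18 * s * μ ^ 2 + 24 * μ ^ 4 := by
    rw [← sub_eq_zero]
    refine pow_eq_zero_iff (three_ne_zero) |>.1 (mul_left_cancel₀ hunit ?_)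
    linear_combination 23328 * (3 * μ) ^ 2 * h0
      - (2916 * (27 * (4 * (3 * s) ^ 2 * (3 * μ) ^ 2 - 48 * b * (3 * μ) ^ 2
        + 4 * (3 * s) ^ 3 - 18 * (3 * s) * b) + (16 * (3 * μ) ^ 3 + 18 * (3 * s) * (3 * μ)) ^ 2)
        + 78732 * (18 * (3 * s) * b - 4 * (3 * s) ^ 3)) * hlin
  obtain rfl : c = s ^ 3 + 9 * s ^ 2 * μ ^ 2 + 24 * s * μ ^ 4 + 16 * μ ^ 6 := by
    have h23328 : (23328 * (3 * μ) ^ 2 : F) ≠ 0 := by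
      rw [show (23328 : F) = 2 * 4 ^ 2 * 27 ^ 2 by norm_num]
      exact mul_ne_zero (mul_ne_zero (mul_ne_zero h2 (pow_ne_zero _ h4)) (pow_ne_zero _ h27))
        (pow_ne_zero _ hm)
    apply mul_left_cancel₀ h23328
    linear_combination hlin
  exact hdisc (by ring)

end

section

open Finset

/-- The discriminant of `u ^ 3 + p u ^ 2 + r u + s`. -/
def cubicDisc {F : Type} [Field F] (p r s : F) : F :=
  p ^ 2 * r ^ 2 - 4 * r ^ 3 - 4 * p ^ 3 * s + 18 * p * r * s - 27 * s ^ 2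

/-- The cubic `u ^ 3 + p u ^ 2 + r u + s` has three distinct roots. -/
def HasThreeRoots {F : Type} [Field F] (p r s : F) : Prop :=
  ∃ u v w : F, u ≠ v ∧ u ≠ w ∧ v ≠ w ∧ u ^ 3 + p * u ^ 2 + r * u + s = 0 ∧
    v ^ 3 + p * v ^ 2 + r * v + s = 0 ∧ w ^ 3 + p * w ^ 2 + r * w + s = 0

lemma cubic_coeffs_of_two_roots {F : Type} [Field F] {p r s u v : F} (huv : u ≠ v)
    (hu : u ^ 3 + p * u ^ 2 + r * u + s = 0) (hv : v ^ 3 + p * v ^ 2 + r * v + s = 0) :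
    r = u * v + (u + v) * (-p - u - v) ∧ s = -(u * v * (-p - u - v)) := by
  have h1 : r = u * v + (u + v) * (-p - u - v) := by
    apply mul_left_cancel₀ (sub_ne_zero.2 huv)
    linear_combination hu - hv
  refine ⟨h1, ?_⟩
  linear_combination hu - u * h1

lemma hasThreeRoots_of_two_roots {p r s u v : F} (hd : cubicDisc p r s ≠ 0) (huv : u ≠ v)
    (hu : u ^ 3 + p * u ^ 2 + r * u + s = 0) (hv : v ^ 3 + p * v ^ 2 + r * v + s = 0) :
    HasThreeRoots p r s := by
  obtain ⟨rfl, rfl⟩ := cubic_coeffs_of_two_roots huv hu hv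
  refine ⟨u, v, -p - u - v, huv, ?_, ?_, hu, hv, by ring⟩
  · intro h
    obtain rfl : p = -2 * u - v := by linear_combination h
    exact hd (by unfold cubicDisc; ring)
  · intro h
    obtain rfl : p = -2 * v - u := by linear_combination h
    exact hd (by unfold cubicDisc; ring)

lemma hasThreeRoots_of_root {p r s u : F} (h2 : (2 : F) ≠ 0) (hd : cubicDisc p r s ≠ 0)
    (hsq : IsSquare (cubicDisc p r s)) (hu : u ^ 3 + p * u ^ 2 + r * u + s = 0) :
    HasThreeRoots p r s := by
  obtain rfl : s = -(u ^ 3 + p * u ^ 2 + r * u) := by linear_combination hu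
  have hfac : cubicDisc p r (-(u ^ 3 + p * u ^ 2 + r * u)) =
      ((p + u) ^ 2 - 4 * (r + u * (p + u))) * (3 * u ^ 2 + 2 * p * u + r) ^ 2 := by
    unfold cubicDisc; ring
  have hder : 3 * u ^ 2 + 2 * p * u + r ≠ 0 := by
    intro h; rw [hfac, h] at hd; exact hd (by ring)
  obtain ⟨t, ht⟩ := hsq
  rw [hfac] at ht
  have hΔ : (p + u) ^ 2 - 4 * (r + u * (p + u)) = (t / (3 * u ^ 2 + 2 * p * u + r)) ^ 2 := by
    rw [div_pow, eq_div_iff (pow_ne_zero 2 hder), ht]; ring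
  generalize t / (3 * u ^ 2 + 2 * p * u + r) = y at hΔ
  obtain ⟨v, hv⟩ : ∃ v, 2 * v = -(p + u) + y := ⟨(-(p + u) + y) / 2, by field_simp⟩
  have hv' : v ^ 2 + (p + u) * v + (r + u * (p + u)) = 0 := by
    apply mul_left_cancel₀ (mul_ne_zero h2 h2)
    linear_combination (2 * v + (p + u) + y) * hv - hΔ
  refine hasThreeRoots_of_two_roots hd (u := u) (v := v) ?_ hu ?_
  · rintro rfl
    exact hder (by linear_combination hv')
  · linear_combination (v - u) * hv'

lemma card_cubic_roots_le_three (p r s : F) :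
    (univ.filter fun u : F => u ^ 3 + p * u ^ 2 + r * u + s = 0).card ≤ 3 := by
  by_contra! h
  obtain ⟨T, hT, hcard⟩ := exists_subset_card_eq (Nat.succ_le_of_lt h)
  obtain ⟨x, y, z, w, hxy, hxz, hxw, hyz, hyw, hzw, rfl⟩ := card_eq_four.1 hcard
  have hx := (mem_filter.1 (hT (by simp : x ∈ _))).2
  have hy := (mem_filter.1 (hT (by simp : y ∈ _))).2
  have hz := (mem_filter.1 (hT (by simp : z ∈ _))).2
  have hw := (mem_filter.1 (hT (by simp : w ∈ _))).2
  have h1 := (cubic_coeffs_of_two_roots hxy hx hy)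
  have e1 : (z - x) * (z - y) * (z - (-p - x - y)) = 0 := by
    linear_combination hz - z * h1.1 - h1.2
  have e2 : (w - x) * (w - y) * (w - (-p - x - y)) = 0 := by
    linear_combination hw - w * h1.1 - h1.2
  have e3 := (mul_eq_zero.1 e1).resolve_left
    (mul_ne_zero (sub_ne_zero.2 hxz.symm) (sub_ne_zero.2 hyz.symm))
  have e4 := (mul_eq_zero.1 e2).resolve_left
    (mul_ne_zero (sub_ne_zero.2 hxw.symm) (sub_ne_zero.2 hyw.symm))
  exact hzw (by linear_combination e3 - e4)

open Classical in
lemma card_cubic_roots_le (h2 : (2 : F) ≠ 0) (p r s : F) :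
    (univ.filter fun u : F => u ^ 3 + p * u ^ 2 + r * u + s = 0).card ≤
      (if cubicDisc p r s ^ (Fintype.card F / 2) = -1 then 1 else 0)
        + 2 * (if cubicDisc p r s = 0 then 1 else 0)
        + 3 * (if HasThreeRoots p r s then 1 else 0) := by
  have hF : ringChar F ≠ 2 := by
    intro h
    have := ringChar.Nat.cast_ringChar (R := F)
    rw [h] at this
    exact h2 (by exact_mod_cast this)
  by_cases h3 : HasThreeRoots p r s
  · rw [if_pos h3]
    exact (card_cubic_roots_le_three p r s).trans (by omega)
  by_cases h0 : cubicDisc p r s = 0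
  · rw [if_pos h0]
    refine le_trans (b := 2) ?_ (by omega)
    by_contra! h
    obtain ⟨x, hx, y, hy, z, hz, hxy, hxz, hyz⟩ := two_lt_card.1 h
    simp only [mem_filter, mem_univ, true_and] at hx hy hz
    exact h3 ⟨x, y, z, hxy, hxz, hyz, hx, hy, hz⟩
  rcases FiniteField.pow_dichotomy hF h0 with h1 | h1
  · have hsq := (FiniteField.isSquare_iff hF h0).2 h1
    rw [filter_eq_empty_iff.2 fun u _ hu => h3 (hasThreeRoots_of_root h2 h0 hsq hu)]
    simp
  · rw [if_pos h1]
    refine le_trans (b := 1) ?_ (by omega)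
    by_contra! h
    obtain ⟨x, hx, y, hy, hxy⟩ := one_lt_card.1 h
    simp only [mem_filter, mem_univ, true_and] at hx hy
    exact h3 (hasThreeRoots_of_two_roots h0 hxy hx hy)

open Classical in
open Polynomial in
/-- Counting the roots in a one-parameter family of cubics whose discriminant is a sextic that is
not a square up to a constant. -/
lemma sum_card_cubic_roots_le (hq : 121 ≤ Fintype.card F) (hodd : Odd (Fintype.card F))
    (p r s : F → F) (d0 d1 d2 d3 d4 d5 d6 : F)
    (hD : ∀ t, cubicDisc (p t) (r t) (s t)
      = d0 + d1 * t + d2 * t ^ 2 + d3 * t ^ 3 + d4 * t ^ 4 + d5 * t ^ 5 + d6 * t ^ 6)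
    (hsq : ∀ (κ : F) (w : F[X]), κ ≠ 0 → C κ * (C d0 + C d1 * X + C d2 * X ^ 2 + C d3 * X ^ 3
      + C d4 * X ^ 4 + C d5 * X ^ 5 + C d6 * X ^ 6) ≠ w ^ 2) :
    6 * ∑ t, (univ.filter fun u : F => u ^ 3 + p t * u ^ 2 + r t * u + s t = 0).card
      ≤ 4 * Fintype.card F + 40
        + 9 * (univ.filter fun t => cubicDisc (p t) (r t) (s t) = 0).card
        + 18 * (univ.filter fun t => HasThreeRoots (p t) (r t) (s t)).card := by
  have h2 : (2 : F) ≠ 0 := two_ne_zero_of_odd hodd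
  have hsum := sum_le_sum fun t (_ : t ∈ (univ : Finset F)) =>
    card_cubic_roots_le h2 (p t) (r t) (s t)
  rw [sum_add_distrib, sum_add_distrib, ← mul_sum, ← mul_sum] at hsum
  simp only [← card_filter] at hsum
  have hb := sextic_bound hq hodd d0 d1 d2 d3 d4 d5 d6 hsq
  simp only [← hD] at hb
  omega

/-- A cubic with vanishing discriminant has a rational multiple root. -/
lemma exists_multiple_root {p r s : F} (h2 : (2 : F) ≠ 0) (h : cubicDisc p r s = 0) :
    ∃ u, u ^ 3 + p * u ^ 2 + r * u + s = 0 ∧ 3 * u ^ 2 + 2 * p * u + r = 0 := by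
  unfold cubicDisc at h
  have h27 : (2 * p ^ 3 - 9 * p * r + 27 * s) ^ 2 = 4 * (p ^ 2 - 3 * r) ^ 3 := by
    linear_combination (-27) * h
  by_cases hL : p ^ 2 - 3 * r = 0
  · have h0 : 2 * p ^ 3 - 9 * p * r + 27 * s = 0 := by
      rw [hL] at h27
      exact pow_eq_zero_iff two_ne_zero |>.1 (h27.trans (by ring))
    by_cases h3 : (3 : F) = 0
    · obtain rfl : p = 0 := pow_eq_zero_iff two_ne_zero |>.1 (by linear_combination hL + r * h3)
      have hr : r = 0 := by
        have : 2 ^ 2 * r ^ 3 = 0 := by linear_combination -h - 9 * s ^ 2 * h3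
        exact pow_eq_zero_iff three_ne_zero |>.1
          ((mul_eq_zero.1 this).resolve_left (pow_ne_zero _ h2))
      subst hr
      have hinj : Function.Injective fun x : F => x ^ 3 := fun x y hxy => by
        refine sub_eq_zero.1 (pow_eq_zero_iff three_ne_zero |>.1 (?_ : (x - y) ^ 3 = 0))
        have hxy' : x ^ 3 = y ^ 3 := hxy
        linear_combination hxy' + (x * y ^ 2 - x ^ 2 * y) * h3
      obtain ⟨u, hu⟩ := Finite.injective_iff_surjective.1 hinj (-s)
      have hu' : u ^ 3 = -s := hu
      exact ⟨u, by linear_combination hu', by linear_combination u ^ 2 * h3⟩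
    · obtain ⟨u, rfl⟩ : ∃ u, p = -3 * u := ⟨-p / 3, by field_simp⟩
      have h9 : (27 : F) ≠ 0 := by
        rw [show (27 : F) = 3 ^ 3 by norm_num]; exact pow_ne_zero _ h3
      refine ⟨u, mul_left_cancel₀ h9 ?_, mul_left_cancel₀ h3 ?_⟩
      · linear_combination h0
      · linear_combination -hL
  · have h2L := mul_ne_zero h2 hL
    obtain ⟨u, hu⟩ : ∃ u, 2 * (p ^ 2 - 3 * r) * u = 9 * s - p * r :=
      ⟨(9 * s - p * r) / (2 * (p ^ 2 - 3 * r)), by field_simp⟩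
    refine ⟨u, mul_left_cancel₀ (pow_ne_zero 3 h2L) ?_, mul_left_cancel₀ (pow_ne_zero 2 h2L) ?_⟩
    · linear_combination ((2 * (p ^ 2 - 3 * r) * u) ^ 2
        + 2 * (p ^ 2 - 3 * r) * u * (9 * s - p * r) + (9 * s - p * r) ^ 2
        + 2 * (p ^ 2 - 3 * r) * p * (2 * (p ^ 2 - 3 * r) * u + (9 * s - p * r))
        + 4 * (p ^ 2 - 3 * r) ^ 2 * r) * hu + (-27 * s - 2 * p ^ 3 + 9 * p * r) * h
    · linear_combination (3 * (2 * (p ^ 2 - 3 * r) * u + (9 * s - p * r))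
        + 4 * (p ^ 2 - 3 * r) * p) * hu - 9 * h

open Polynomial in
lemma card_eval_eq_zero_le {P : F[X]} (hP : P ≠ 0) {k : ℕ} (hk : P.natDegree ≤ k) :
    (univ.filter fun x => P.eval x = 0).card ≤ k := by
  refine (card_le_card fun x hx => ?_ : _ ≤ P.roots.toFinset.card).trans
    ((Multiset.toFinset_card_le _).trans ((card_roots' P).trans hk))
  simpa [hP] using hx

/-- The affine points of `y ^ 2 = x ^ 3 + a x ^ 2 + b x + c`. -/
def affinePoints (a b c : F) : Finset (F × F) :=
  univ.filter fun P => P.2 ^ 2 = P.1 ^ 3 + a * P.1 ^ 2 + b * P.1 + c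

/-- The affine points of the cubic at which the tangent passes through `(r₀ : r₁ : r₂)`. -/
def tangentPoints (a b c r₀ r₁ r₂ : F) : Finset (F × F) :=
  (affinePoints a b c).filter fun P =>
    r₀ * (P.1 * (3 * P.1 ^ 2 + 2 * a * P.1 + b) - 2 * P.2 ^ 2)
      - r₁ * (3 * P.1 ^ 2 + 2 * a * P.1 + b) + 2 * P.2 * r₂ = 0

open Classical in
/-- Counting the affine points along the lines through an affine point off the curve. -/
lemma affine_pencil_bound (hq : 121 ≤ Fintype.card F) (hodd : Odd (Fintype.card F)) {a b c : F}
    (hj : a ^ 2 - 3 * b ≠ 0) (hdisc : cubicDisc a b c ≠ 0) {x₀ y₀ : F}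
    (he : x₀ ^ 3 + a * x₀ ^ 2 + b * x₀ + c - y₀ ^ 2 ≠ 0) :
    6 * (affinePoints a b c).card ≤ 4 * Fintype.card F + 40
        + 9 * (univ.filter fun t => cubicDisc (3 * x₀ + a - t ^ 2)
          (3 * x₀ ^ 2 + 2 * a * x₀ + b - 2 * y₀ * t)
          (x₀ ^ 3 + a * x₀ ^ 2 + b * x₀ + c - y₀ ^ 2) = 0).card
        + 18 * (univ.filter fun t => HasThreeRoots (3 * x₀ + a - t ^ 2)
          (3 * x₀ ^ 2 + 2 * a * x₀ + b - 2 * y₀ * t)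
          (x₀ ^ 3 + a * x₀ ^ 2 + b * x₀ + c - y₀ ^ 2)).card
        + 6 * (univ.filter fun y => y ^ 2 = x₀ ^ 3 + a * x₀ ^ 2 + b * x₀ + c).card ∧
    (univ.filter fun t => cubicDisc (3 * x₀ + a - t ^ 2)
          (3 * x₀ ^ 2 + 2 * a * x₀ + b - 2 * y₀ * t)
          (x₀ ^ 3 + a * x₀ ^ 2 + b * x₀ + c - y₀ ^ 2) = 0).card ≤ 6 := by
  have h2 : (2 : F) ≠ 0 := two_ne_zero_of_odd hodd
  have hsq := fun (κ : F) (w : Polynomial F) (hκ : κ ≠ 0) => affine_disc_ne_sq h2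
    (A := 3 * x₀ + a) (B := 3 * x₀ ^ 2 + 2 * a * x₀ + b) (c := x₀ ^ 3 + a * x₀ ^ 2 + b * x₀ + c)
    (y := y₀) he (fun h => hj (by linear_combination h))
    (fun h => hdisc (by unfold cubicDisc; linear_combination h)) hκ w
  have hb := sum_card_cubic_roots_le hq hodd (fun t => 3 * x₀ + a - t ^ 2)
    (fun t => 3 * x₀ ^ 2 + 2 * a * x₀ + b - 2 * y₀ * t)
    (fun _ => x₀ ^ 3 + a * x₀ ^ 2 + b * x₀ + c - y₀ ^ 2) _ _ _ _ _ _ _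
    (fun t => by unfold cubicDisc; ring) hsq
  constructor
  · have hvert : ((affinePoints a b c).filter fun P => P.1 = x₀).card ≤
        (univ.filter fun y => y ^ 2 = x₀ ^ 3 + a * x₀ ^ 2 + b * x₀ + c).card := by
      refine card_le_card_of_injOn Prod.snd ?_ ?_
      · rintro ⟨x, y⟩ h
        simp only [affinePoints, coe_filter, mem_filter, mem_univ, true_and,
          Set.mem_ofPred_eq] at h ⊢
        rw [h.1, h.2]
      · rintro ⟨x, y⟩ h ⟨x', y'⟩ h' hyy
        simp only [coe_filter, Set.mem_ofPred_eq] at h h' hyy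
        rw [h.2, h'.2, hyy]
    have hslope : ((affinePoints a b c).filter fun P => ¬P.1 = x₀).card ≤
        ∑ t, (univ.filter fun u : F => u ^ 3 + (3 * x₀ + a - t ^ 2) * u ^ 2
          + (3 * x₀ ^ 2 + 2 * a * x₀ + b - 2 * y₀ * t) * u
          + (x₀ ^ 3 + a * x₀ ^ 2 + b * x₀ + c - y₀ ^ 2) = 0).card := by
      rw [card_eq_sum_card_fiberwise (f := fun P : F × F => (P.2 - y₀) / (P.1 - x₀)) (t := univ)
        (fun _ _ => by simp)]
      refine sum_le_sum fun t _ => card_le_card_of_injOn (fun P => P.1 - x₀) ?_ ?_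
      · rintro ⟨x, y⟩ h
        simp only [affinePoints, coe_filter, mem_filter, mem_univ, true_and,
          Set.mem_ofPred_eq] at h ⊢
        obtain ⟨⟨h1, h2⟩, h3⟩ := h
        rw [div_eq_iff (sub_ne_zero.2 h2)] at h3
        linear_combination -h1 + (y + y₀ + t * (x - x₀)) * h3
      · rintro ⟨x, y⟩ h ⟨x', y'⟩ h' hxx
        simp only [coe_filter, mem_filter, Set.mem_ofPred_eq] at h h' hxx
        obtain rfl : x = x' := by linear_combination hxx
        have h3 := h.2
        have h3' := h'.2
        rw [div_eq_iff (sub_ne_zero.2 h.1.2)] at h3 h3'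
        rw [show y = y' by linear_combination h3 - h3']
    have := card_filter_add_card_filter_not (s := affinePoints a b c) (fun P => P.1 = x₀)
    omega
  · have hP := hsq 1 0 one_ne_zero
    rw [map_one, one_mul, zero_pow two_ne_zero] at hP
    refine le_trans (card_le_card fun t ht => ?_) (card_eval_eq_zero_le hP (k := 6) ?_)
    · simp only [mem_filter, mem_univ, true_and] at ht ⊢
      simp only [Polynomial.eval_add, Polynomial.eval_mul, Polynomial.eval_C, Polynomial.eval_X,
        Polynomial.eval_pow]
      refine Eq.trans ?_ ht
      unfold cubicDisc
      ring
    · compute_degree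

open Classical in
/-- Counting the affine points along the lines of slope `m`. -/
lemma parallel_pencil_bound (hq : 121 ≤ Fintype.card F) (hodd : Odd (Fintype.card F)) {a b c : F}
    (hj : a ^ 2 - 3 * b ≠ 0) (hdisc : cubicDisc a b c ≠ 0) (m : F) :
    6 * (affinePoints a b c).card ≤ 4 * Fintype.card F + 40
        + 9 * (univ.filter fun t =>
          cubicDisc (a - m ^ 2) (b - 2 * m * t) (c - t ^ 2) = 0).card
        + 18 * (univ.filter fun t =>
          HasThreeRoots (a - m ^ 2) (b - 2 * m * t) (c - t ^ 2)).card ∧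
    (univ.filter fun t => cubicDisc (a - m ^ 2) (b - 2 * m * t) (c - t ^ 2) = 0).card ≤ 6 := by
  have h2 : (2 : F) ≠ 0 := two_ne_zero_of_odd hodd
  have hsq := fun (κ : F) (w : Polynomial F) (hκ : κ ≠ 0) => parallel_disc_ne_sq h2
    (c := c) (m := m) rfl hj (fun h => hdisc (by unfold cubicDisc; linear_combination h)) hκ w
  have hb := sum_card_cubic_roots_le hq hodd (fun _ => a - m ^ 2) (fun t => b - 2 * m * t)
    (fun t => c - t ^ 2) _ _ _ _ _ _ _ (fun t => by unfold cubicDisc; ring) hsq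
  constructor
  · have hslope : (affinePoints a b c).card ≤
        ∑ t, (univ.filter fun u : F => u ^ 3 + (a - m ^ 2) * u ^ 2 + (b - 2 * m * t) * u
          + (c - t ^ 2) = 0).card := by
      rw [card_eq_sum_card_fiberwise (f := fun P : F × F => P.2 - m * P.1) (t := univ)
        (fun _ _ => by simp)]
      refine sum_le_sum fun t _ => card_le_card_of_injOn Prod.fst ?_ ?_
      · rintro ⟨x, y⟩ h
        simp only [affinePoints, coe_filter, mem_filter, mem_univ, true_and,
          Set.mem_ofPred_eq] at h ⊢
        linear_combination -h.1 + (y + m * x + t) * h.2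
      · rintro ⟨x, y⟩ h ⟨x', y'⟩ h' hxx
        simp only [coe_filter, Set.mem_ofPred_eq] at h h' hxx
        subst hxx
        rw [show y = y' by linear_combination h.2 - h'.2]
    omega
  · have hP := hsq 1 0 one_ne_zero
    rw [map_one, one_mul, zero_pow two_ne_zero] at hP
    refine le_trans (card_le_card fun t ht => ?_) (card_eval_eq_zero_le hP (k := 6) ?_)
    · simp only [mem_filter, mem_univ, true_and] at ht ⊢
      simp only [Polynomial.eval_add, Polynomial.eval_mul, Polynomial.eval_C, Polynomial.eval_X,
        Polynomial.eval_pow]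
      refine Eq.trans ?_ ht
      unfold cubicDisc
      ring
    · compute_degree

lemma card_affine_disc_zeros_le (h2 : (2 : F) ≠ 0) {a b c x₀ y₀ : F}
    (he : x₀ ^ 3 + a * x₀ ^ 2 + b * x₀ + c - y₀ ^ 2 ≠ 0) :
    (univ.filter fun t => cubicDisc (3 * x₀ + a - t ^ 2)
          (3 * x₀ ^ 2 + 2 * a * x₀ + b - 2 * y₀ * t)
          (x₀ ^ 3 + a * x₀ ^ 2 + b * x₀ + c - y₀ ^ 2) = 0).card
      + (if x₀ ^ 3 + a * x₀ ^ 2 + b * x₀ + c = 0 then 1 else 0)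
      ≤ (tangentPoints a b c 1 x₀ y₀).card := by
  rw [← card_filter_add_card_filter_not (s := tangentPoints a b c 1 x₀ y₀) (fun P => ¬P.1 = x₀)]
  gcongr
  · refine le_trans (card_le_card fun t ht => ?_)
      (card_image_le (f := fun P : F × F => (P.2 - y₀) / (P.1 - x₀)))
    obtain ⟨u, hu, hu'⟩ := exists_multiple_root h2 (mem_filter.1 ht).2
    have hu0 : u ≠ 0 := by
      rintro rfl
      exact he (by linear_combination hu)
    simp only [tangentPoints, affinePoints, mem_image, mem_filter, mem_univ, true_and]
    refine ⟨(x₀ + u, y₀ + t * u), ⟨⟨by linear_combination -hu, ?_⟩, by simpa using hu0⟩, ?_⟩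
    · linear_combination u * hu'
    · simp only [add_sub_cancel_left]
      exact mul_div_cancel_right₀ _ hu0
  · split_ifs with hC
    · refine card_pos.2 ⟨(x₀, 0), ?_⟩
      simp only [tangentPoints, affinePoints, mem_filter, mem_univ, true_and, not_true_eq_false,
        not_false_eq_true, and_true]
      exact ⟨by linear_combination -hC, by ring⟩
    · exact Nat.zero_le _

lemma card_parallel_disc_zeros_le (h2 : (2 : F) ≠ 0) (a b c m : F) :
    (univ.filter fun t => cubicDisc (a - m ^ 2) (b - 2 * m * t) (c - t ^ 2) = 0).card
      ≤ (tangentPoints a b c 0 1 m).card := by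
  refine le_trans (card_le_card fun t ht => ?_)
    (card_image_le (f := fun P : F × F => P.2 - m * P.1))
  obtain ⟨u, hu, hu'⟩ := exists_multiple_root h2 (mem_filter.1 ht).2
  simp only [tangentPoints, affinePoints, mem_image, mem_filter, mem_univ, true_and]
  refine ⟨(u, m * u + t), ⟨by linear_combination -hu, by linear_combination -hu'⟩, by ring⟩

lemma card_sq_eq_le_two (C : F) : (univ.filter fun y : F => y ^ 2 = C).card ≤ 2 := by
  by_contra! h
  obtain ⟨x, hx, y, hy, z, hz, hxy, hxz, hyz⟩ := two_lt_card.1 h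
  simp only [mem_filter, mem_univ, true_and] at hx hy hz
  have h1 : x + y = 0 := by
    apply mul_left_cancel₀ (sub_ne_zero.2 hxy)
    linear_combination hx - hy
  have h2 : x + z = 0 := by
    apply mul_left_cancel₀ (sub_ne_zero.2 hxz)
    linear_combination hx - hz
  exact hyz (by linear_combination h1 - h2)

lemma card_sq_eq_le_ite {C : F} (h : ∀ s, s ≠ 0 → s ^ 2 ≠ C) :
    (univ.filter fun y : F => y ^ 2 = C).card ≤ if C = 0 then 1 else 0 := by
  split_ifs with hC
  · refine (card_le_card fun y hy => ?_).trans (card_singleton (0 : F)).le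
    by_contra hy0
    exact h y (by simpa using hy0) (mem_filter.1 hy).2
  · rw [filter_eq_empty_iff.2 fun y _ hy => ?_, card_empty]
    refine h y ?_ hy
    rintro rfl
    exact hC (by rw [← hy]; ring)

/-- The bound from an affine point `(x₀, y₀)` off the curve with few tangents, when every line
through it meeting the curve in three affine points contains a point with abscissa `z`. -/
lemma card_le_of_affine (hq : 121 ≤ Fintype.card F) (hodd : Odd (Fintype.card F)) {a b c : F}
    (hj : a ^ 2 - 3 * b ≠ 0) (hdisc : cubicDisc a b c ≠ 0) {x₀ y₀ z : F}
    (he : x₀ ^ 3 + a * x₀ ^ 2 + b * x₀ + c - y₀ ^ 2 ≠ 0)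
    (hline : ∀ t k x₁ x₂ x₃ : F, x₁ ≠ x₂ → x₁ ≠ x₃ → x₂ ≠ x₃ → x₁ ≠ z → x₂ ≠ z → x₃ ≠ z →
      (t * x₁ + k) ^ 2 = x₁ ^ 3 + a * x₁ ^ 2 + b * x₁ + c →
      (t * x₂ + k) ^ 2 = x₂ ^ 3 + a * x₂ ^ 2 + b * x₂ + c →
      (t * x₃ + k) ^ 2 = x₃ ^ 3 + a * x₃ ^ 2 + b * x₃ + c → y₀ ≠ t * x₀ + k)
    (hvert : ∀ s, s ≠ 0 → s ^ 2 = x₀ ^ 3 + a * x₀ ^ 2 + b * x₀ + c → x₀ = z)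
    (htan : (tangentPoints a b c 1 x₀ y₀).card ≤ 3) :
    6 * (affinePoints a b c).card ≤ 4 * Fintype.card F + 103 := by
  classical
  have h2 : (2 : F) ≠ 0 := two_ne_zero_of_odd hodd
  have hz : ∀ t, HasThreeRoots (3 * x₀ + a - t ^ 2) (3 * x₀ ^ 2 + 2 * a * x₀ + b - 2 * y₀ * t)
      (x₀ ^ 3 + a * x₀ ^ 2 + b * x₀ + c - y₀ ^ 2) →
      (y₀ + t * (z - x₀)) ^ 2 = z ^ 3 + a * z ^ 2 + b * z + c := by
    rintro t ⟨u, v, w, huv, huw, hvw, hu, hv, hw⟩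
    by_cases h1 : x₀ + u = z
    · obtain rfl : u = z - x₀ := by linear_combination h1
      linear_combination -hu
    by_cases h2 : x₀ + v = z
    · obtain rfl : v = z - x₀ := by linear_combination h2
      linear_combination -hv
    by_cases h3 : x₀ + w = z
    · obtain rfl : w = z - x₀ := by linear_combination h3
      linear_combination -hw
    refine absurd ?_ (hline t (y₀ - t * x₀) (x₀ + u) (x₀ + v) (x₀ + w) (by simpa using huv)
      (by simpa using huw) (by simpa using hvw) h1 h2 h3 (by linear_combination -hu)
      (by linear_combination -hv) (by linear_combination -hw))
    ring
  obtain ⟨hb, -⟩ := affine_pencil_bound hq hodd hj hdisc he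
  have hN := card_affine_disc_zeros_le h2 he
  by_cases hzx : x₀ = z
  · subst hzx
    have h3 : ∀ t, ¬HasThreeRoots (3 * x₀ + a - t ^ 2)
        (3 * x₀ ^ 2 + 2 * a * x₀ + b - 2 * y₀ * t)
        (x₀ ^ 3 + a * x₀ ^ 2 + b * x₀ + c - y₀ ^ 2) :=
      fun t ht => he (by linear_combination -(hz t ht))
    rw [filter_false_of_mem (s := univ) fun t _ => h3 t, card_empty] at hb
    have := card_sq_eq_le_two (x₀ ^ 3 + a * x₀ ^ 2 + b * x₀ + c)
    omega
  · have h3 : (univ.filter fun t => HasThreeRoots (3 * x₀ + a - t ^ 2)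
        (3 * x₀ ^ 2 + 2 * a * x₀ + b - 2 * y₀ * t)
        (x₀ ^ 3 + a * x₀ ^ 2 + b * x₀ + c - y₀ ^ 2)).card ≤ 2 := by
      refine le_trans (card_le_card_of_injOn (fun t => y₀ + t * (z - x₀)) (fun t ht => ?_)
        fun t _ t' _ htt => ?_) (card_sq_eq_le_two (z ^ 3 + a * z ^ 2 + b * z + c))
      · simpa using hz t (mem_filter.1 ht).2
      · exact mul_right_cancel₀ (sub_ne_zero.2 (Ne.symm hzx)) (add_left_cancel htt)
    have hv := card_sq_eq_le_ite fun s hs hs' => hzx (hvert s hs hs')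
    split_ifs at hN hv <;> omega

lemma card_le_of_parallel (hq : 121 ≤ Fintype.card F) (hodd : Odd (Fintype.card F)) {a b c : F}
    (hj : a ^ 2 - 3 * b ≠ 0) (hdisc : cubicDisc a b c ≠ 0) {m z : F}
    (hline : ∀ k x₁ x₂ x₃ : F, x₁ ≠ x₂ → x₁ ≠ x₃ → x₂ ≠ x₃ → x₁ ≠ z → x₂ ≠ z → x₃ ≠ z →
      (m * x₁ + k) ^ 2 = x₁ ^ 3 + a * x₁ ^ 2 + b * x₁ + c →
      (m * x₂ + k) ^ 2 = x₂ ^ 3 + a * x₂ ^ 2 + b * x₂ + c →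
      (m * x₃ + k) ^ 2 ≠ x₃ ^ 3 + a * x₃ ^ 2 + b * x₃ + c)
    (htan : (tangentPoints a b c 0 1 m).card ≤ 3) :
    6 * (affinePoints a b c).card ≤ 4 * Fintype.card F + 103 := by
  classical
  have h2 : (2 : F) ≠ 0 := two_ne_zero_of_odd hodd
  have hz : ∀ t, HasThreeRoots (a - m ^ 2) (b - 2 * m * t) (c - t ^ 2) →
      (m * z + t) ^ 2 = z ^ 3 + a * z ^ 2 + b * z + c := by
    rintro t ⟨u, v, w, huv, huw, hvw, hu, hv, hw⟩
    by_cases h1 : u = z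
    · subst h1
      linear_combination -hu
    by_cases h2 : v = z
    · subst h2
      linear_combination -hv
    by_cases h3 : w = z
    · subst h3
      linear_combination -hw
    exact absurd (by linear_combination -hw) (hline t u v w huv huw hvw h1 h2 h3
      (by linear_combination -hu) (by linear_combination -hv))
  obtain ⟨hb, -⟩ := parallel_pencil_bound hq hodd hj hdisc m
  have hN := card_parallel_disc_zeros_le h2 a b c m
  have h3 : (univ.filter fun t =>
      HasThreeRoots (a - m ^ 2) (b - 2 * m * t) (c - t ^ 2)).card ≤ 2 := by
    refine le_trans (card_le_card_of_injOn (fun t => m * z + t) (fun t ht => ?_)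
      fun t _ t' _ htt => ?_) (card_sq_eq_le_two (z ^ 3 + a * z ^ 2 + b * z + c))
    · simpa using hz t (mem_filter.1 ht).2
    · exact add_left_cancel htt
  omega

/-- The bound from an affine point off the curve that lies on no line meeting the curve in three
affine points. -/
lemma card_le_of_affine_of_no_trisecant (hq : 121 ≤ Fintype.card F)
    (hodd : Odd (Fintype.card F)) {a b c : F}
    (hj : a ^ 2 - 3 * b ≠ 0) (hdisc : cubicDisc a b c ≠ 0) {x₀ y₀ : F}
    (he : x₀ ^ 3 + a * x₀ ^ 2 + b * x₀ + c - y₀ ^ 2 ≠ 0)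
    (hline : ∀ t k x₁ x₂ x₃ : F, x₁ ≠ x₂ → x₁ ≠ x₃ → x₂ ≠ x₃ →
      (t * x₁ + k) ^ 2 = x₁ ^ 3 + a * x₁ ^ 2 + b * x₁ + c →
      (t * x₂ + k) ^ 2 = x₂ ^ 3 + a * x₂ ^ 2 + b * x₂ + c →
      (t * x₃ + k) ^ 2 = x₃ ^ 3 + a * x₃ ^ 2 + b * x₃ + c → y₀ ≠ t * x₀ + k)
    (hvert : ∀ s, s ≠ 0 → s ^ 2 ≠ x₀ ^ 3 + a * x₀ ^ 2 + b * x₀ + c) :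
    6 * (affinePoints a b c).card ≤ 4 * Fintype.card F + 103 := by
  classical
  obtain ⟨hb, h6⟩ := affine_pencil_bound hq hodd hj hdisc he
  have hv := card_sq_eq_le_ite hvert
  have h3 : ∀ t, ¬HasThreeRoots (3 * x₀ + a - t ^ 2) (3 * x₀ ^ 2 + 2 * a * x₀ + b - 2 * y₀ * t)
      (x₀ ^ 3 + a * x₀ ^ 2 + b * x₀ + c - y₀ ^ 2) := by
    rintro t ⟨u, v, w, huv, huw, hvw, hu, hv, hw⟩
    refine absurd ?_ (hline t (y₀ - t * x₀) (x₀ + u) (x₀ + v) (x₀ + w) (by simpa using huv)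
      (by simpa using huw) (by simpa using hvw) (by linear_combination -hu)
      (by linear_combination -hv) (by linear_combination -hw))
    ring
  rw [filter_false_of_mem (s := univ) fun t _ => h3 t, card_empty] at hb
  split_ifs at hv <;> omega

lemma card_le_of_parallel_of_no_trisecant (hq : 121 ≤ Fintype.card F)
    (hodd : Odd (Fintype.card F)) {a b c : F}
    (hj : a ^ 2 - 3 * b ≠ 0) (hdisc : cubicDisc a b c ≠ 0) {m : F}
    (hline : ∀ k x₁ x₂ x₃ : F, x₁ ≠ x₂ → x₁ ≠ x₃ → x₂ ≠ x₃ →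
      (m * x₁ + k) ^ 2 = x₁ ^ 3 + a * x₁ ^ 2 + b * x₁ + c →
      (m * x₂ + k) ^ 2 = x₂ ^ 3 + a * x₂ ^ 2 + b * x₂ + c →
      (m * x₃ + k) ^ 2 ≠ x₃ ^ 3 + a * x₃ ^ 2 + b * x₃ + c) :
    6 * (affinePoints a b c).card ≤ 4 * Fintype.card F + 103 := by
  classical
  obtain ⟨hb, h6⟩ := parallel_pencil_bound hq hodd hj hdisc m
  have h3 : ∀ t, ¬HasThreeRoots (a - m ^ 2) (b - 2 * m * t) (c - t ^ 2) := by
    rintro t ⟨u, v, w, huv, huw, hvw, hu, hv, hw⟩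
    exact absurd (by linear_combination -hw) (hline t u v w huv huw hvw
      (by linear_combination -hu) (by linear_combination -hv))
  rw [filter_false_of_mem (s := univ) fun t _ => h3 t, card_empty] at hb
  omega

/-- The abscissae of the affine points with nonzero ordinate. -/
def abscissae (a b c : F) : Finset F :=
  univ.filter fun z => ∃ s, s ≠ 0 ∧ s ^ 2 = z ^ 3 + a * z ^ 2 + b * z + c

lemma card_affinePoints_le_abscissae (a b c : F) :
    (affinePoints a b c).card ≤ 2 * (abscissae a b c).card + 3 := by
  rw [← card_filter_add_card_filter_not (s := affinePoints a b c) (fun P => ¬P.2 = 0)]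
  gcongr
  · refine card_le_mul_card_image_of_maps_to (f := Prod.fst) ?_ 2 ?_
    · rintro ⟨x, y⟩ h
      simp only [affinePoints, mem_filter, mem_univ, true_and] at h
      simp only [abscissae, mem_filter, mem_univ, true_and]
      exact ⟨y, h.2, h.1⟩
    · intro z _
      refine (card_le_card_of_injOn Prod.snd ?_ ?_).trans
        (card_sq_eq_le_two (z ^ 3 + a * z ^ 2 + b * z + c))
      · rintro ⟨x, y⟩ h
        simp only [affinePoints, coe_filter, mem_filter, mem_univ, true_and,
          Set.mem_ofPred_eq] at h ⊢
        rw [h.1.1, h.2]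
      · rintro ⟨x, y⟩ h ⟨x', y'⟩ h' hyy
        simp only [coe_filter, Set.mem_ofPred_eq] at h h' hyy
        rw [h.2, h'.2, hyy]
  · refine (card_le_card_of_injOn Prod.fst ?_ ?_).trans (card_cubic_roots_le_three a b c)
    · rintro ⟨x, y⟩ h
      simp only [affinePoints, coe_filter, mem_filter, mem_univ, true_and, not_not,
        Set.mem_ofPred_eq] at h ⊢
      rw [← h.1, h.2]
      ring
    · rintro ⟨x, y⟩ h ⟨x', y'⟩ h' hxx
      simp only [coe_filter, Set.mem_ofPred_eq, not_not] at h h' hxx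
      rw [h.2, h'.2, hxx]

lemma tangent_ne_zero {a b c x y : F} (h2 : (2 : F) ≠ 0) (hdisc : cubicDisc a b c ≠ 0)
    (h : y ^ 2 = x ^ 3 + a * x ^ 2 + b * x + c) :
    ¬(3 * x ^ 2 + 2 * a * x + b = 0 ∧ 2 * y = 0) := by
  rintro ⟨h1, h3⟩
  obtain rfl : y = 0 := (mul_eq_zero.1 h3).resolve_left h2
  obtain rfl : b = -3 * x ^ 2 - 2 * a * x := by linear_combination h1
  obtain rfl : c = 2 * x ^ 3 + a * x ^ 2 := by linear_combination -h
  exact hdisc (by unfold cubicDisc; ring)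

/-- Two points of the cubic each lying on the tangent at the other coincide. -/
lemma eq_of_mem_tangents {a b c x y x' y' : F} (h2 : (2 : F) ≠ 0)
    (h : y ^ 2 = x ^ 3 + a * x ^ 2 + b * x + c)
    (h' : y' ^ 2 = x' ^ 3 + a * x' ^ 2 + b * x' + c)
    (ht : (x * (3 * x ^ 2 + 2 * a * x + b) - 2 * y ^ 2)
      - x' * (3 * x ^ 2 + 2 * a * x + b) + 2 * y * y' = 0)
    (ht' : (x' * (3 * x' ^ 2 + 2 * a * x' + b) - 2 * y' ^ 2)
      - x * (3 * x' ^ 2 + 2 * a * x' + b) + 2 * y' * y = 0) :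
    x = x' ∧ y = y' := by
  have hx : x = x' := by
    refine sub_eq_zero.1 (pow_eq_zero_iff three_ne_zero |>.1 (?_ : (x - x') ^ 3 = 0))
    linear_combination ht - ht' + 2 * h - 2 * h'
  subst hx
  refine ⟨rfl, ?_⟩
  have : 2 * (y - y') ^ 2 = 0 := by linear_combination -ht - ht'
  exact sub_eq_zero.1 (pow_eq_zero_iff two_ne_zero |>.1 ((mul_eq_zero.1 this).resolve_left h2))

/-- A vector orthogonal to two vectors with nonzero cross product is a multiple of it. -/
lemma exists_smul_cross {a₀ a₁ a₂ b₀ b₁ b₂ t₀ t₁ t₂ : F}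
    (hn : ¬(a₁ * b₂ - a₂ * b₁ = 0 ∧ a₂ * b₀ - a₀ * b₂ = 0 ∧ a₀ * b₁ - a₁ * b₀ = 0))
    (ha : t₀ * a₀ + t₁ * a₁ + t₂ * a₂ = 0) (hb : t₀ * b₀ + t₁ * b₁ + t₂ * b₂ = 0) :
    ∃ l, t₀ = l * (a₁ * b₂ - a₂ * b₁) ∧ t₁ = l * (a₂ * b₀ - a₀ * b₂)
      ∧ t₂ = l * (a₀ * b₁ - a₁ * b₀) := by
  have e01 : t₀ * (a₂ * b₀ - a₀ * b₂) = t₁ * (a₁ * b₂ - a₂ * b₁) := by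
    linear_combination a₂ * hb - b₂ * ha
  have e02 : t₀ * (a₀ * b₁ - a₁ * b₀) = t₂ * (a₁ * b₂ - a₂ * b₁) := by
    linear_combination b₁ * ha - a₁ * hb
  have e12 : t₁ * (a₀ * b₁ - a₁ * b₀) = t₂ * (a₂ * b₀ - a₀ * b₂) := by
    linear_combination a₀ * hb - b₀ * ha
  generalize a₁ * b₂ - a₂ * b₁ = n₀, a₂ * b₀ - a₀ * b₂ = n₁, a₀ * b₁ - a₁ * b₀ = n₂ at *
  by_cases h0 : n₀ = 0
  · by_cases h1 : n₁ = 0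
    · have h2 : n₂ ≠ 0 := fun h2 => hn ⟨h0, h1, h2⟩
      refine ⟨t₂ / n₂, ?_, ?_, ?_⟩ <;> field_simp <;>
        first | linear_combination e02 | linear_combination e12
    · refine ⟨t₁ / n₁, ?_, ?_, ?_⟩ <;> field_simp <;>
        first | linear_combination e01 | linear_combination -e12
  · refine ⟨t₀ / n₀, ?_, ?_, ?_⟩ <;> field_simp <;>
      first | linear_combination -e01 | linear_combination -e02

/-- The points `(a₀ - z b₀ : a₁ - z b₁ : a₂ - z b₂)` of a line, at most three of which lie on the
cubic. -/
lemma card_line_inter_cubic_le {a b c a₀ a₁ a₂ b₀ b₁ b₂ : F}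
    (hn : ¬(a₁ * b₂ - a₂ * b₁ = 0 ∧ a₂ * b₀ - a₀ * b₂ = 0 ∧ a₀ * b₁ - a₁ * b₀ = 0)) :
    (univ.filter fun z : F => (a₂ - z * b₂) ^ 2 * (a₀ - z * b₀) - ((a₁ - z * b₁) ^ 3
      + a * (a₁ - z * b₁) ^ 2 * (a₀ - z * b₀) + b * (a₁ - z * b₁) * (a₀ - z * b₀) ^ 2
      + c * (a₀ - z * b₀) ^ 3) = 0).card ≤ 3 := by
  let P : Cubic F := ⟨-(b₂ ^ 2 * b₀ - (b₁ ^ 3 + a * b₁ ^ 2 * b₀ + b * b₁ * b₀ ^ 2 + c * b₀ ^ 3)),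
    b₂ ^ 2 * a₀ + 2 * a₂ * b₂ * b₀ - (3 * a₁ * b₁ ^ 2 + a * (b₁ ^ 2 * a₀ + 2 * a₁ * b₁ * b₀)
      + b * (a₁ * b₀ ^ 2 + 2 * b₁ * a₀ * b₀) + 3 * c * a₀ * b₀ ^ 2),
    -(2 * a₂ * b₂ * a₀ + a₂ ^ 2 * b₀ - (3 * a₁ ^ 2 * b₁ + a * (2 * a₁ * b₁ * a₀ + a₁ ^ 2 * b₀)
      + b * (b₁ * a₀ ^ 2 + 2 * a₁ * a₀ * b₀) + 3 * c * a₀ ^ 2 * b₀)),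
    a₂ ^ 2 * a₀ - (a₁ ^ 3 + a * a₁ ^ 2 * a₀ + b * a₁ * a₀ ^ 2 + c * a₀ ^ 3)⟩
  have hP : P.toPoly ≠ 0 := by
    intro hP
    have h3 : P.a = 0 := by rw [← P.coeff_eq_a, hP, Polynomial.coeff_zero]
    have h2 : P.b = 0 := by rw [← P.coeff_eq_b, hP, Polynomial.coeff_zero]
    have h1 : P.c = 0 := by rw [← P.coeff_eq_c, hP, Polynomial.coeff_zero]
    have h0 : P.d = 0 := by rw [← P.coeff_eq_d, hP, Polynomial.coeff_zero]
    simp only [P] at h0 h1 h2 h3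
    apply hn
    by_cases hb : b₀ = 0
    · subst hb
      obtain rfl : b₁ = 0 := pow_eq_zero_iff three_ne_zero |>.1 (by linear_combination h3)
      have h : b₂ ^ 2 * a₀ = 0 := by linear_combination h2
      rcases mul_eq_zero.1 h with h | rfl
      · obtain rfl : b₂ = 0 := pow_eq_zero_iff two_ne_zero |>.1 h
        exact ⟨by ring, by ring, by ring⟩
      · obtain rfl : a₁ = 0 := pow_eq_zero_iff three_ne_zero |>.1 (by linear_combination -h0)
        exact ⟨by ring, by ring, by ring⟩
    · obtain ⟨w, rfl⟩ : ∃ w, a₀ = w * b₀ := ⟨a₀ / b₀, by field_simp⟩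
      have e1 : a₁ = w * b₁ := by
        refine sub_eq_zero.1 (pow_eq_zero_iff three_ne_zero |>.1
          (?_ : (a₁ - w * b₁) ^ 3 = 0))
        linear_combination -h0 - w * h1 - w ^ 2 * h2 - w ^ 3 * h3
      subst e1
      have e2 : a₂ = w * b₂ := by
        have h : (a₂ - w * b₂) ^ 2 * b₀ = 0 := by
          linear_combination -h1 - 2 * w * h2 - 3 * w ^ 2 * h3
        exact sub_eq_zero.1 (pow_eq_zero_iff two_ne_zero |>.1 ((mul_eq_zero.1 h).resolve_right hb))
      subst e2
      exact ⟨by ring, by ring, by ring⟩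
  refine (card_le_card fun z hz => ?_).trans (card_eval_eq_zero_le hP (k := 3) ?_)
  · simp only [mem_filter, mem_univ, true_and] at hz ⊢
    simp only [Cubic.toPoly, P, Polynomial.eval_add, Polynomial.eval_mul, Polynomial.eval_C,
      Polynomial.eval_pow, Polynomial.eval_X]
    linear_combination hz
  · exact Polynomial.natDegree_cubic_le

/-- Some point of a pencil line, off the curve, lies on at most three tangents at affine points. -/
lemma exists_few_tangents (h2 : (2 : F) ≠ 0) {a b c a₀ a₁ a₂ b₀ b₁ b₂ : F}
    (hdisc : cubicDisc a b c ≠ 0) (hcard : 28 ≤ (affinePoints a b c).card)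
    (hn : ¬(a₁ * b₂ - a₂ * b₁ = 0 ∧ a₂ * b₀ - a₀ * b₂ = 0 ∧ a₀ * b₁ - a₁ * b₀ = 0)) :
    ∃ z ∈ abscissae a b c, (a₂ - z * b₂) ^ 2 * (a₀ - z * b₀) - ((a₁ - z * b₁) ^ 3
      + a * (a₁ - z * b₁) ^ 2 * (a₀ - z * b₀) + b * (a₁ - z * b₁) * (a₀ - z * b₀) ^ 2
      + c * (a₀ - z * b₀) ^ 3) ≠ 0 ∧
      (tangentPoints a b c (a₀ - z * b₀) (a₁ - z * b₁) (a₂ - z * b₂)).card ≤ 3 := by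
  by_contra! hcon
  set S := (abscissae a b c).filter fun z => ¬((a₂ - z * b₂) ^ 2 * (a₀ - z * b₀)
      - ((a₁ - z * b₁) ^ 3 + a * (a₁ - z * b₁) ^ 2 * (a₀ - z * b₀)
      + b * (a₁ - z * b₁) * (a₀ - z * b₀) ^ 2 + c * (a₀ - z * b₀) ^ 3) = 0) with hS
  have hScard : (abscissae a b c).card ≤ S.card + 3 := by
    rw [← card_filter_add_card_filter_not (s := abscissae a b c) (fun z =>
      ¬((a₂ - z * b₂) ^ 2 * (a₀ - z * b₀) - ((a₁ - z * b₁) ^ 3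
      + a * (a₁ - z * b₁) ^ 2 * (a₀ - z * b₀)
      + b * (a₁ - z * b₁) * (a₀ - z * b₀) ^ 2 + c * (a₀ - z * b₀) ^ 3) = 0))]
    gcongr
    refine (card_le_card fun z hz => ?_).trans
      (card_line_inter_cubic_le (a := a) (b := b) (c := c) hn)
    simpa using (mem_filter.1 hz).2
  have hlow : S.card * 4 ≤ ∑ z ∈ S,
      (tangentPoints a b c (a₀ - z * b₀) (a₁ - z * b₁) (a₂ - z * b₂)).card := by
    rw [← smul_eq_mul]
    refine card_nsmul_le_sum _ _ _ fun z hz => ?_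
    obtain ⟨hz1, hz2⟩ := mem_filter.1 hz
    exact hcon z hz1 hz2
  -- the tangent at `P` passes through at most one of the points unless it contains the whole line
  let α : F × F → F := fun P => a₀ * (P.1 * (3 * P.1 ^ 2 + 2 * a * P.1 + b) - 2 * P.2 ^ 2)
      - a₁ * (3 * P.1 ^ 2 + 2 * a * P.1 + b) + 2 * P.2 * a₂
  let β : F × F → F := fun P => b₀ * (P.1 * (3 * P.1 ^ 2 + 2 * a * P.1 + b) - 2 * P.2 ^ 2)
      - b₁ * (3 * P.1 ^ 2 + 2 * a * P.1 + b) + 2 * P.2 * b₂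
  have hex : ((affinePoints a b c).filter fun P => α P = 0 ∧ β P = 0).card ≤ 1 := by
    rw [card_le_one]
    rintro ⟨x, y⟩ hP ⟨x', y'⟩ hP'
    simp only [affinePoints, mem_filter, mem_univ, true_and, α, β] at hP hP'
    obtain ⟨hP, hPa, hPb⟩ := hP
    obtain ⟨hP', hPa', hPb'⟩ := hP'
    obtain ⟨l, e0, e1, e2⟩ := exists_smul_cross hn
      (t₀ := x * (3 * x ^ 2 + 2 * a * x + b) - 2 * y ^ 2) (t₁ := -(3 * x ^ 2 + 2 * a * x + b))
      (t₂ := 2 * y) (by linear_combination hPa) (by linear_combination hPb)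
    obtain ⟨l', e0', e1', e2'⟩ := exists_smul_cross hn
      (t₀ := x' * (3 * x' ^ 2 + 2 * a * x' + b) - 2 * y' ^ 2)
      (t₁ := -(3 * x' ^ 2 + 2 * a * x' + b))
      (t₂ := 2 * y') (by linear_combination hPa') (by linear_combination hPb')
    have hl : l ≠ 0 := by
      rintro rfl
      exact tangent_ne_zero h2 hdisc hP ⟨by linear_combination -e1, by linear_combination e2⟩
    have hl' : l' ≠ 0 := by
      rintro rfl
      exact tangent_ne_zero h2 hdisc hP' ⟨by linear_combination -e1', by linear_combination e2'⟩
    generalize a₁ * b₂ - a₂ * b₁ = n₀, a₂ * b₀ - a₀ * b₂ = n₁, a₀ * b₁ - a₁ * b₀ = n₂ at *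
    have hs : n₀ + x * n₁ + y * n₂ = 0 := by
      apply mul_left_cancel₀ hl
      linear_combination -e0 - x * e1 - y * e2
    have hs' : n₀ + x' * n₁ + y' * n₂ = 0 := by
      apply mul_left_cancel₀ hl'
      linear_combination -e0' - x' * e1' - y' * e2'
    obtain ⟨rfl, rfl⟩ := eq_of_mem_tangents h2 hP hP'
      (by linear_combination e0 + x' * e1 + y' * e2 + l * hs')
      (by linear_combination e0' + x * e1' + y * e2' + l' * hs)
    rfl
  have hup : ∑ z ∈ S, (tangentPoints a b c (a₀ - z * b₀) (a₁ - z * b₁) (a₂ - z * b₂)).card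
      ≤ (affinePoints a b c).card + S.card := by
    simp only [tangentPoints]
    have hswap := sum_card_bipartiteAbove_eq_sum_card_bipartiteBelow (s := S)
      (t := affinePoints a b c) (fun z P =>
        (a₀ - z * b₀) * (P.1 * (3 * P.1 ^ 2 + 2 * a * P.1 + b) - 2 * P.2 ^ 2)
        - (a₁ - z * b₁) * (3 * P.1 ^ 2 + 2 * a * P.1 + b) + 2 * P.2 * (a₂ - z * b₂) = 0)
    simp only [bipartiteAbove, bipartiteBelow] at hswap
    rw [hswap]
    have hP : ∀ P ∈ affinePoints a b c, (S.filter fun z =>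
        (a₀ - z * b₀) * (P.1 * (3 * P.1 ^ 2 + 2 * a * P.1 + b) - 2 * P.2 ^ 2)
        - (a₁ - z * b₁) * (3 * P.1 ^ 2 + 2 * a * P.1 + b) + 2 * P.2 * (a₂ - z * b₂) = 0).card
        ≤ 1 + (if α P = 0 ∧ β P = 0 then 1 else 0) * S.card := by
      intro P _
      split_ifs with h
      · rw [one_mul]
        exact (card_filter_le _ _).trans (Nat.le_add_left _ _)
      · rw [zero_mul, add_zero, card_le_one]
        intro z hz z' hz'
        have e : α P - z * β P = 0 := by
          simp only [α, β]
          linear_combination (mem_filter.1 hz).2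
        have e' : α P - z' * β P = 0 := by
          simp only [α, β]
          linear_combination (mem_filter.1 hz').2
        have hβ : β P ≠ 0 := fun hβ => h ⟨by rw [hβ] at e; linear_combination e, hβ⟩
        apply mul_right_cancel₀ hβ
        linear_combination e' - e
    refine (sum_le_sum hP).trans ?_
    rw [sum_add_distrib, ← sum_mul, ← card_filter]
    simp only [sum_const, smul_eq_mul, mul_one]
    gcongr
    exact (Nat.mul_le_mul_right _ hex).trans (one_mul _).le
  have := card_affinePoints_le_abscissae a b c
  omega

lemma tangentPoints_smul {l : F} (hl : l ≠ 0) (a b c r₀ r₁ r₂ : F) :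
    tangentPoints a b c (l * r₀) (l * r₁) (l * r₂) = tangentPoints a b c r₀ r₁ r₂ := by
  unfold tangentPoints
  refine filter_congr fun P _ => ?_
  rw [← mul_eq_zero_iff_left hl (b := r₀ * _ - _ + _)]
  ring_nf

lemma exists_mem_abscissae_avoiding {a b c : F} (hcard : 28 ≤ (affinePoints a b c).card)
    (x₁ x₂ x₃ : F) : ∃ z s, s ≠ 0 ∧ s ^ 2 = z ^ 3 + a * z ^ 2 + b * z + c ∧
      x₁ ≠ z ∧ x₂ ≠ z ∧ x₃ ≠ z := by
  have hlt : ({x₁, x₂, x₃} : Finset F).card < (abscissae a b c).card := by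
    have := card_affinePoints_le_abscissae a b c
    have := card_le_three (a := x₁) (b := x₂) (c := x₃)
    omega
  obtain ⟨z, hz, hz'⟩ := exists_mem_notMem_of_card_lt_card hlt
  obtain ⟨s, hs, hsz⟩ := (mem_filter.1 hz).2
  simp only [mem_insert, mem_singleton, not_or] at hz'
  exact ⟨z, s, hs, hsz, Ne.symm hz'.1, Ne.symm hz'.2.1, Ne.symm hz'.2.2⟩

/-- A point off the image of the cubic under `(1 : X : Y : X² : XY)` lying on none of the
hyperplanes `(X - z)(Y - tX - k) = 0` and `(X - z)(X - x₁) = 0` which meet the image in five points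
forces the cubic to have few affine points. -/
lemma card_affinePoints_le_of_avoids (hq : 121 ≤ Fintype.card F) (hodd : Odd (Fintype.card F))
    {a b c Q₁ Q₂ Q₃ Q₄ Q₅ : F} (hj : a ^ 2 - 3 * b ≠ 0) (hdisc : cubicDisc a b c ≠ 0)
    (hcard : 28 ≤ (affinePoints a b c).card)
    (hline : ∀ z s, s ≠ 0 → s ^ 2 = z ^ 3 + a * z ^ 2 + b * z + c → ∀ t k x₁ x₂ x₃,
      x₁ ≠ x₂ → x₁ ≠ x₃ → x₂ ≠ x₃ → x₁ ≠ z → x₂ ≠ z → x₃ ≠ z →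
      (t * x₁ + k) ^ 2 = x₁ ^ 3 + a * x₁ ^ 2 + b * x₁ + c →
      (t * x₂ + k) ^ 2 = x₂ ^ 3 + a * x₂ ^ 2 + b * x₂ + c →
      (t * x₃ + k) ^ 2 = x₃ ^ 3 + a * x₃ ^ 2 + b * x₃ + c →
      (Q₅ - z * Q₃) - t * (Q₄ - z * Q₂) - k * (Q₂ - z * Q₁) ≠ 0)
    (hvert : ∀ z s x₁ s₁, s ≠ 0 → s ^ 2 = z ^ 3 + a * z ^ 2 + b * z + c → s₁ ≠ 0 →
      s₁ ^ 2 = x₁ ^ 3 + a * x₁ ^ 2 + b * x₁ + c → z ≠ x₁ →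
      z * x₁ * Q₁ - (z + x₁) * Q₂ + Q₄ ≠ 0)
    (hQ : ∀ l x y, l ≠ 0 → y ^ 2 = x ^ 3 + a * x ^ 2 + b * x + c →
      ¬(Q₁ = l ∧ Q₂ = l * x ∧ Q₃ = l * y ∧ Q₄ = l * x ^ 2 ∧ Q₅ = l * (x * y)))
    (hQ' : ¬(Q₁ = 0 ∧ Q₂ = 0 ∧ Q₃ = 0 ∧ Q₄ = 0)) :
    6 * (affinePoints a b c).card ≤ 4 * Fintype.card F + 103 := by
  by_cases hn : Q₄ * Q₃ - Q₅ * Q₂ = 0 ∧ Q₅ * Q₁ - Q₂ * Q₃ = 0 ∧ Q₂ * Q₂ - Q₄ * Q₁ = 0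
  · obtain ⟨hn0, hn1, hn2⟩ := hn
    by_cases h1 : Q₁ = 0
    · subst h1
      obtain rfl : Q₂ = 0 := mul_self_eq_zero.1 (by linear_combination hn2)
      by_cases h3 : Q₃ = 0
      · subst h3
        have h4 : Q₄ ≠ 0 := fun h4 => hQ' ⟨rfl, rfl, rfl, h4⟩
        refine card_le_of_parallel_of_no_trisecant (m := Q₅ / Q₄) hq hodd hj hdisc
          fun k x₁ x₂ x₃ h12 h13 h23 e1 e2 e3 => ?_
        obtain ⟨z, s, hs, hsz, hz1, hz2, hz3⟩ := exists_mem_abscissae_avoiding hcard x₁ x₂ x₃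
        refine hline z s hs hsz _ k x₁ x₂ x₃ h12 h13 h23 hz1 hz2 hz3 e1 e2 e3 ?_
        field_simp
        ring
      · exfalso
        obtain rfl : Q₄ = 0 :=
          (mul_eq_zero.1 (by linear_combination hn0 : Q₄ * Q₃ = 0)).resolve_right h3
        obtain ⟨z, s, hs, hsz, -⟩ := exists_mem_abscissae_avoiding hcard 0 0 0
        obtain ⟨z', s', hs', hsz', hzz, -⟩ := exists_mem_abscissae_avoiding hcard z z z
        exact hvert z s z' s' hs hsz hs' hsz' hzz (by ring)
    · have e2 : Q₂ = Q₁ * (Q₂ / Q₁) := by field_simp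
      have e3 : Q₃ = Q₁ * (Q₃ / Q₁) := by field_simp
      generalize Q₂ / Q₁ = x₀ at e2
      generalize Q₃ / Q₁ = y₀ at e3
      subst e2 e3
      obtain rfl : Q₄ = Q₁ * x₀ ^ 2 := by
        apply mul_left_cancel₀ h1
        linear_combination -hn2
      obtain rfl : Q₅ = Q₁ * (x₀ * y₀) := by
        apply mul_left_cancel₀ h1
        linear_combination hn1
      refine card_le_of_affine_of_no_trisecant (x₀ := x₀) (y₀ := y₀) hq hodd hj hdisc ?_ ?_ ?_
      · intro he
        exact hQ Q₁ x₀ y₀ h1 (by linear_combination -he) ⟨rfl, rfl, rfl, rfl, rfl⟩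
      · intro t k x₁ x₂ x₃ h12 h13 h23 e1 e2 e3 h
        obtain ⟨z, s, hs, hsz, hz1, hz2, hz3⟩ := exists_mem_abscissae_avoiding hcard x₁ x₂ x₃
        refine hline z s hs hsz t k x₁ x₂ x₃ h12 h13 h23 hz1 hz2 hz3 e1 e2 e3 ?_
        linear_combination (Q₁ * x₀ - z * Q₁) * h
      · intro s hs hsx
        obtain ⟨z, s', hs', hsz', hzz, -⟩ := exists_mem_abscissae_avoiding hcard x₀ x₀ x₀
        exact hvert z s' x₀ s hs' hsz' hs hsx hzz.symm (by ring)
  · obtain ⟨z, hz, hG, htan⟩ := exists_few_tangents (two_ne_zero_of_odd hodd) hdisc hcard hn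
    obtain ⟨s, hs, hsz⟩ := (mem_filter.1 hz).2
    by_cases h0 : Q₂ - z * Q₁ = 0
    · rw [h0] at hG htan
      have h1 : Q₄ - z * Q₂ ≠ 0 := fun h1 => hG (by rw [h1]; ring)
      refine card_le_of_parallel (m := (Q₅ - z * Q₃) / (Q₄ - z * Q₂)) (z := z) hq hodd hj hdisc
        (fun k x₁ x₂ x₃ h12 h13 h23 hz1 hz2 hz3 e1 e2 e3 => ?_) ?_
      · refine hline z s hs hsz _ k x₁ x₂ x₃ h12 h13 h23 hz1 hz2 hz3 e1 e2 e3 ?_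
        rw [h0, div_mul_cancel₀ _ h1]
        ring
      · rw [← tangentPoints_smul h1, mul_zero, mul_one, mul_div_cancel₀ _ h1]
        exact htan
    · have hx : (Q₂ - z * Q₁) * ((Q₄ - z * Q₂) / (Q₂ - z * Q₁)) = Q₄ - z * Q₂ :=
        mul_div_cancel₀ _ h0
      have hy : (Q₂ - z * Q₁) * ((Q₅ - z * Q₃) / (Q₂ - z * Q₁)) = Q₅ - z * Q₃ :=
        mul_div_cancel₀ _ h0
      generalize (Q₄ - z * Q₂) / (Q₂ - z * Q₁) = x₀ at hx
      generalize (Q₅ - z * Q₃) / (Q₂ - z * Q₁) = y₀ at hy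
      refine card_le_of_affine (x₀ := x₀) (y₀ := y₀) (z := z) hq hodd hj hdisc ?_ ?_ ?_ ?_
      · intro he
        apply hG
        rw [← hx, ← hy]
        linear_combination -(Q₂ - z * Q₁) ^ 3 * he
      · intro t k x₁ x₂ x₃ h12 h13 h23 hz1 hz2 hz3 e1 e2 e3 h
        refine hline z s hs hsz t k x₁ x₂ x₃ h12 h13 h23 hz1 hz2 hz3 e1 e2 e3 ?_
        rw [← hx, ← hy]
        linear_combination (Q₂ - z * Q₁) * h
      · intro s' hs' hsx
        by_contra hne
        refine hvert z s x₀ s' hs hsz hs' hsx (Ne.symm hne) ?_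
        linear_combination -hx
      · rw [← tangentPoints_smul h0, mul_one, hx, hy]
        exact htan

lemma two_le_card_sqrts_add (hodd : Odd (Fintype.card F)) (d : F) :
    2 ≤ (univ.filter fun y : F => y ^ 2 = d).card
      + (2 * (if d ^ (Fintype.card F / 2) = -1 then 1 else 0) + if d = 0 then 1 else 0) := by
  have h2 : (2 : F) ≠ 0 := two_ne_zero_of_odd hodd
  have hchar : ringChar F ≠ 2 := by
    intro h
    apply h2
    have := ringChar.Nat.cast_ringChar (R := F)
    rw [h] at this
    exact_mod_cast this
  by_cases hd : d = 0
  · have : 0 < (univ.filter fun y : F => y ^ 2 = d).card :=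
      card_pos.2 ⟨0, by simp [hd]⟩
    simp only [hd, if_true] at this ⊢
    omega
  · rcases FiniteField.pow_dichotomy hchar hd with h | h
    · obtain ⟨y, rfl⟩ := (FiniteField.isSquare_iff hchar hd).2 h
      have hy : y ≠ 0 := by rintro rfl; simp at hd
      have hne : y ≠ -y := by
        intro hyy
        exact (mul_ne_zero h2 hy) (by linear_combination hyy)
      have : ({y, -y} : Finset F) ⊆ univ.filter fun w : F => w ^ 2 = y * y := by
        intro w hw
        simp only [mem_insert, mem_singleton] at hw
        rcases hw with rfl | rfl <;> simp [sq]
      have := card_le_card this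
      rw [card_pair hne] at this
      omega
    · rw [if_pos h]
      omega

lemma card_affinePoints_eq_sum (a b c : F) : (affinePoints a b c).card
    = ∑ x : F, (univ.filter fun y : F => y ^ 2 = x ^ 3 + a * x ^ 2 + b * x + c).card := by
  simp only [affinePoints, card_filter]
  rw [Fintype.sum_prod_type]

lemma le_card_affinePoints (hq : 121 ≤ Fintype.card F) (hodd : Odd (Fintype.card F))
    {a b c e₁ e₂ e₃ : F} (h12 : e₁ ≠ e₂) (h13 : e₁ ≠ e₃) (h23 : e₂ ≠ e₃)
    (he : ∀ x, x ^ 3 + a * x ^ 2 + b * x + c = (x - e₁) * (x - e₂) * (x - e₃))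
    (hd : 3 * e₁ ^ 2 + 2 * a * e₁ + b ≠ 0) :
    6 * Fintype.card F ≤ 7 * (affinePoints a b c).card + 45 := by
  have hb := cubic_bound hq hodd a b c e₁ (by rw [he]; ring) hd
  have hroots : 3 ≤ (univ.filter fun x : F => x ^ 3 + a * x ^ 2 + b * x + c = 0).card := by
    refine (card_eq_three.2 ⟨e₁, e₂, e₃, h12, h13, h23, rfl⟩).ge.trans
      (card_le_card fun x hx => ?_)
    simp only [mem_insert, mem_singleton] at hx
    simp only [mem_filter, mem_univ, true_and, he]
    rcases hx with rfl | rfl | rfl <;> ring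
  have hsum := sum_le_sum fun (x : F) (_ : x ∈ univ) =>
    two_le_card_sqrts_add hodd (x ^ 3 + a * x ^ 2 + b * x + c)
  rw [sum_add_distrib, sum_add_distrib, ← mul_sum, ← card_filter, ← card_filter,
    ← card_affinePoints_eq_sum, sum_const, card_univ, smul_eq_mul] at hsum
  omega

lemma card_ne_123 : Fintype.card F ≠ 123 := by
  intro h
  obtain ⟨p, n, hp, -, e⟩ := FiniteField.isPrimePow_card F
  rw [h] at e
  have h3 : 3 ∣ p := Nat.Prime.dvd_of_dvd_pow (by norm_num) (n := n) (by rw [e]; norm_num)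
  have h41 : 41 ∣ p := Nat.Prime.dvd_of_dvd_pow (by norm_num) (n := n) (by rw [e]; norm_num)
  rw [Nat.prime_dvd_prime_iff_eq (by norm_num) hp.nat_prime] at h3 h41
  omega

/-- A monic cubic with three known distinct roots is the product of its linear factors. -/
lemma cubic_eq_prod {p r s u v w : F} (huv : u ≠ v) (huw : u ≠ w) (hvw : v ≠ w)
    (hu : u ^ 3 + p * u ^ 2 + r * u + s = 0) (hv : v ^ 3 + p * v ^ 2 + r * v + s = 0)
    (hw : w ^ 3 + p * w ^ 2 + r * w + s = 0) (x : F) :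
    x ^ 3 + p * x ^ 2 + r * x + s = (x - u) * (x - v) * (x - w) := by
  obtain ⟨rfl, rfl⟩ := cubic_coeffs_of_two_roots huv hu hv
  have h : (u - w) * ((v - w) * (w + p + u + v)) = 0 := by linear_combination hw
  have h' := (mul_eq_zero.1 ((mul_eq_zero.1 h).resolve_left (sub_ne_zero.2 huw))).resolve_left
    (sub_ne_zero.2 hvw)
  obtain rfl : p = -u - v - w := by linear_combination h'
  ring

lemma onHyp_mk {k : ℕ} (a v : Fin k → F) (hv : v ≠ 0) :
    OnHyp a (Projectivization.mk F v hv) ↔ ∑ i, a i * v i = 0 := by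
  obtain ⟨u, hu⟩ := Projectivization.exists_smul_eq_mk_rep F v hv
  have : ∑ i, a i * (u • v) i = u * ∑ i, a i * v i := by
    rw [mul_sum]
    refine sum_congr rfl fun i _ => ?_
    rw [Pi.smul_apply, Units.smul_def, smul_eq_mul]
    ring
  rw [OnHyp, ← hu, this, Units.mul_right_eq_zero]

lemma phiVec_five_zero (W : WeierstrassCurve F) :
    phiVec W 5 .zero = ![0, 0, 0, 0, 1] := by
  ext i
  fin_cases i <;> simp [phiVec]

lemma phiVec_five_some (W : WeierstrassCurve F) {x y : F} (h : W.toAffine.Nonsingular x y) :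
    phiVec W 5 (.some x y h) = ![1, x, y, x ^ 2, x * y] := by
  ext i
  fin_cases i <;> simp [phiVec, psi]

lemma phiProj_five_injective (W : WeierstrassCurve F) :
    Function.Injective (phiProj W (k := 5) (by norm_num)) := by
  intro P P' h
  obtain ⟨l, hl⟩ := (Projectivization.mk_eq_mk_iff' F _ _ _ _).1 h
  cases P with
  | zero =>
    cases P' with
    | zero => rfl
    | some x' y' h' =>
      rw [phiVec_five_zero, phiVec_five_some] at hl
      have h0 := congrFun hl 0
      have h4 := congrFun hl 4
      simp at h0 h4
      simp [h0] at h4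
  | some x y h =>
    cases P' with
    | zero =>
      rw [phiVec_five_zero, phiVec_five_some] at hl
      have h0 := congrFun hl 0
      simp at h0
    | some x' y' h' =>
      rw [phiVec_five_some, phiVec_five_some] at hl
      have h0 := congrFun hl 0
      have h1 := congrFun hl 1
      have h2 := congrFun hl 2
      simp at h0 h1 h2
      subst h0
      simp only [one_mul] at h1 h2
      subst h1 h2
      rfl

lemma ncard_hyperplane_section (W : WeierstrassCurve F) (a : Fin 5 → F) :
    Set.ncard {p ∈ Set.range (phiProj W (k := 5) (by norm_num)) | OnHyp a p}
      = Set.ncard {P : W.toAffine.Point | ∑ i, a i * phiVec W 5 P i = 0} := by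
  rw [← Set.ncard_image_of_injective _ (phiProj_five_injective W)]
  congr 1
  ext p
  constructor
  · rintro ⟨⟨P, rfl⟩, hP⟩
    exact ⟨P, (onHyp_mk _ _ _).1 hP, rfl⟩
  · rintro ⟨P, hP, rfl⟩
    exact ⟨⟨P, rfl⟩, (onHyp_mk _ _ _).2 hP⟩

lemma ncard_eq_five {α : Type*} {p₁ p₂ p₃ p₄ p₅ : α} (h12 : p₁ ≠ p₂) (h13 : p₁ ≠ p₃)
    (h14 : p₁ ≠ p₄) (h15 : p₁ ≠ p₅) (h23 : p₂ ≠ p₃) (h24 : p₂ ≠ p₄) (h25 : p₂ ≠ p₅)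
    (h34 : p₃ ≠ p₄) (h35 : p₃ ≠ p₅) (h45 : p₄ ≠ p₅) :
    ({p₁, p₂, p₃, p₄, p₅} : Set α).ncard = 5 := by
  rw [Set.ncard_insert_of_notMem (by simp [*]), Set.ncard_insert_of_notMem (by simp [*]),
    Set.ncard_insert_of_notMem (by simp [*]), Set.ncard_pair h45]

lemma equation_iff_of_canonical {W : WeierstrassCurve F} (ha₁ : W.a₁ = 0) (ha₃ : W.a₃ = 0)
    (x y : F) : W.toAffine.Equation x y ↔
      y ^ 2 = x ^ 3 + W.a₂ * x ^ 2 + W.a₄ * x + W.a₆ := by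
  rw [Affine.equation_iff, ha₁, ha₃]
  simp

/-- The hyperplane `(X - z)(Y - tX - k) = 0` through two points of abscissa `z` and three points on
the line `Y = tX + k`. -/
lemma ncard_section_eq_five_of_line (h2 : (2 : F) ≠ 0) {W : WeierstrassCurve F}
    (ha₁ : W.a₁ = 0) (ha₃ : W.a₃ = 0) [W.IsElliptic] {z s t k x₁ x₂ x₃ : F} (hs : s ≠ 0)
    (hz : s ^ 2 = z ^ 3 + W.a₂ * z ^ 2 + W.a₄ * z + W.a₆)
    (h12 : x₁ ≠ x₂) (h13 : x₁ ≠ x₃) (h23 : x₂ ≠ x₃) (h1z : x₁ ≠ z) (h2z : x₂ ≠ z) (h3z : x₃ ≠ z)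
    (e₁ : (t * x₁ + k) ^ 2 = x₁ ^ 3 + W.a₂ * x₁ ^ 2 + W.a₄ * x₁ + W.a₆)
    (e₂ : (t * x₂ + k) ^ 2 = x₂ ^ 3 + W.a₂ * x₂ ^ 2 + W.a₄ * x₂ + W.a₆)
    (e₃ : (t * x₃ + k) ^ 2 = x₃ ^ 3 + W.a₂ * x₃ ^ 2 + W.a₄ * x₃ + W.a₆) :
    Set.ncard {P : W.toAffine.Point |
      ∑ i, ![z * k, z * t - k, -z, -t, 1] i * phiVec W 5 P i = 0} = 5 := by
  have hns : ∀ {x y : F}, y ^ 2 = x ^ 3 + W.a₂ * x ^ 2 + W.a₄ * x + W.a₆ →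
      W.toAffine.Nonsingular x y := fun h =>
    Affine.equation_iff_nonsingular.1 ((equation_iff_of_canonical ha₁ ha₃ _ _).2 h)
  have hz' : (-s) ^ 2 = z ^ 3 + W.a₂ * z ^ 2 + W.a₄ * z + W.a₆ := by rw [neg_sq, hz]
  have hss : s ≠ -s := fun h => mul_ne_zero h2 hs (by linear_combination h)
  refine (congrArg Set.ncard ?_).trans (ncard_eq_five (p₁ := Affine.Point.some z s (hns hz))
    (p₂ := Affine.Point.some z (-s) (hns hz')) (p₃ := Affine.Point.some x₁ _ (hns e₁))
    (p₄ := Affine.Point.some x₂ _ (hns e₂)) (p₅ := Affine.Point.some x₃ _ (hns e₃))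
    ?_ ?_ ?_ ?_ ?_ ?_ ?_ ?_ ?_ ?_)
  · ext P
    simp only [Set.mem_ofPred_eq, Set.mem_insert_iff, Set.mem_singleton_iff]
    cases P with
    | zero =>
      rw [phiVec_five_zero]
      simp [Fin.sum_univ_succ]
    | some x y h =>
      have he := (equation_iff_of_canonical ha₁ ha₃ x y).1 h.1
      have hval : ∑ i, ![z * k, z * t - k, -z, -t, 1] i * phiVec W 5 (.some x y h) i
          = (x - z) * (y - (t * x + k)) := by
        rw [phiVec_five_some]
        simp [Fin.sum_univ_succ]
        ring
      rw [hval]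
      simp only [Affine.Point.some.injEq, mul_eq_zero, sub_eq_zero]
      constructor
      · rintro (rfl | hy)
        · have : (y - s) * (y + s) = 0 := by linear_combination he - hz
          rcases mul_eq_zero.1 this with h | h
          · exact Or.inl ⟨rfl, sub_eq_zero.1 h⟩
          · exact Or.inr (Or.inl ⟨rfl, eq_neg_of_add_eq_zero_left h⟩)
        · have := cubic_eq_prod (p := W.a₂ - t ^ 2) (r := W.a₄ - 2 * t * k) (s := W.a₆ - k ^ 2)
            h12 h13 h23 (by linear_combination -e₁) (by linear_combination -e₂)
            (by linear_combination -e₃) x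
          rw [hy] at he
          have h0 : (x - x₁) * (x - x₂) * (x - x₃) = 0 := by rw [← this]; linear_combination -he
          simp only [mul_eq_zero, sub_eq_zero] at h0
          rcases h0 with (rfl | rfl) | rfl
          · exact Or.inr (Or.inr (Or.inl ⟨rfl, hy⟩))
          · exact Or.inr (Or.inr (Or.inr (Or.inl ⟨rfl, hy⟩)))
          · exact Or.inr (Or.inr (Or.inr (Or.inr ⟨rfl, hy⟩)))
      · rintro (⟨rfl, -⟩ | ⟨rfl, -⟩ | ⟨rfl, hy⟩ | ⟨rfl, hy⟩ | ⟨rfl, hy⟩)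
        · exact Or.inl rfl
        · exact Or.inl rfl
        all_goals exact Or.inr hy
  all_goals simp [hss, h12, h13, h23, h1z.symm, h2z.symm, h3z.symm]

/-- The hyperplane `(X - z)(X - x₁) = 0` through the point at infinity and the points of abscissae
`z` and `x₁`. -/
lemma ncard_section_eq_five_of_vertical (h2 : (2 : F) ≠ 0) {W : WeierstrassCurve F}
    (ha₁ : W.a₁ = 0) (ha₃ : W.a₃ = 0) [W.IsElliptic] {z s x₁ s₁ : F} (hs : s ≠ 0)
    (hz : s ^ 2 = z ^ 3 + W.a₂ * z ^ 2 + W.a₄ * z + W.a₆) (hs₁ : s₁ ≠ 0)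
    (hx₁ : s₁ ^ 2 = x₁ ^ 3 + W.a₂ * x₁ ^ 2 + W.a₄ * x₁ + W.a₆) (hne : z ≠ x₁) :
    Set.ncard {P : W.toAffine.Point |
      ∑ i, ![z * x₁, -(z + x₁), 0, 1, 0] i * phiVec W 5 P i = 0} = 5 := by
  have hns : ∀ {x y : F}, y ^ 2 = x ^ 3 + W.a₂ * x ^ 2 + W.a₄ * x + W.a₆ →
      W.toAffine.Nonsingular x y := fun h =>
    Affine.equation_iff_nonsingular.1 ((equation_iff_of_canonical ha₁ ha₃ _ _).2 h)
  have hz' : (-s) ^ 2 = z ^ 3 + W.a₂ * z ^ 2 + W.a₄ * z + W.a₆ := by rw [neg_sq, hz]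
  have hx₁' : (-s₁) ^ 2 = x₁ ^ 3 + W.a₂ * x₁ ^ 2 + W.a₄ * x₁ + W.a₆ := by rw [neg_sq, hx₁]
  have hss : s ≠ -s := fun h => mul_ne_zero h2 hs (by linear_combination h)
  have hss₁ : s₁ ≠ -s₁ := fun h => mul_ne_zero h2 hs₁ (by linear_combination h)
  refine (congrArg Set.ncard ?_).trans (ncard_eq_five (p₁ := Affine.Point.some z s (hns hz))
    (p₂ := Affine.Point.some z (-s) (hns hz')) (p₃ := Affine.Point.some x₁ _ (hns hx₁))
    (p₄ := Affine.Point.some x₁ _ (hns hx₁')) (p₅ := Affine.Point.zero)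
    ?_ ?_ ?_ ?_ ?_ ?_ ?_ ?_ ?_ ?_)
  · ext P
    simp only [Set.mem_ofPred_eq, Set.mem_insert_iff, Set.mem_singleton_iff]
    cases P with
    | zero =>
      rw [phiVec_five_zero]
      simp [Fin.sum_univ_succ]
    | some x y h =>
      have he := (equation_iff_of_canonical ha₁ ha₃ x y).1 h.1
      have hval : ∑ i, ![z * x₁, -(z + x₁), 0, 1, 0] i * phiVec W 5 (.some x y h) i
          = (x - z) * (x - x₁) := by
        rw [phiVec_five_some]
        simp [Fin.sum_univ_succ]
        ring
      rw [hval]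
      simp only [Affine.Point.some.injEq, mul_eq_zero, sub_eq_zero, reduceCtorEq, or_false]
      constructor
      · rintro (rfl | rfl)
        · have : (y - s) * (y + s) = 0 := by linear_combination he - hz
          rcases mul_eq_zero.1 this with h | h
          · exact Or.inl ⟨rfl, sub_eq_zero.1 h⟩
          · exact Or.inr (Or.inl ⟨rfl, eq_neg_of_add_eq_zero_left h⟩)
        · have : (y - s₁) * (y + s₁) = 0 := by linear_combination he - hx₁
          rcases mul_eq_zero.1 this with h | h
          · exact Or.inr (Or.inr (Or.inl ⟨rfl, sub_eq_zero.1 h⟩))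
          · exact Or.inr (Or.inr (Or.inr ⟨rfl, eq_neg_of_add_eq_zero_left h⟩))
      · rintro (⟨rfl, -⟩ | ⟨rfl, -⟩ | ⟨rfl, -⟩ | ⟨rfl, -⟩)
        · exact Or.inl rfl
        · exact Or.inl rfl
        all_goals exact Or.inr rfl
  all_goals simp [hss, hss₁, hne]

end

/-- Let `q ≥ 121` be odd, `E : Y² = X³ + aX² + bX + c` with `j(E) ≠ 0`,
the frame chosen so that the line `X = 0` meets `E` in two affine rational points distinct
from `(0,0)`, and the lines `Y = 0` and `X = Y` each meet `E` in three affine rational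
points. If `Q = (Q₁ : Q₂ : Q₃ : Q₄ : Q₅)` can be added to the `(n; 5, 3)`-set `φ₅(E(F_q))`,
then `Q₅Q₂ ≠ 0`, `Q₄ = 0` and `(X, Y) = (0, Q₅/Q₂)` lies on `E`. -/
theorem statement10 (hq : 121 ≤ Fintype.card F) (hodd : Odd (Fintype.card F))
    (W : WeierstrassCurve F) (ha₁ : W.a₁ = 0) (ha₃ : W.a₃ = 0) [W.IsElliptic]
    (hj : W.j ≠ 0)
    (hlineX : ∃ y₁ y₂ : F, y₁ ≠ y₂ ∧ y₁ ≠ 0 ∧ y₂ ≠ 0 ∧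
      W.toAffine.Equation 0 y₁ ∧ W.toAffine.Equation 0 y₂)
    (hlineY : ∃ x₁ x₂ x₃ : F, x₁ ≠ x₂ ∧ x₁ ≠ x₃ ∧ x₂ ≠ x₃ ∧
      W.toAffine.Equation x₁ 0 ∧ W.toAffine.Equation x₂ 0 ∧ W.toAffine.Equation x₃ 0)
    (hlineXY : ∃ t₁ t₂ t₃ : F, t₁ ≠ t₂ ∧ t₁ ≠ t₃ ∧ t₂ ≠ t₃ ∧
      W.toAffine.Equation t₁ t₁ ∧ W.toAffine.Equation t₂ t₂ ∧ W.toAffine.Equation t₃ t₃)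
    (Qv : Fin 5 → F) (hQv : Qv ≠ 0)
    (hQnotin : Projectivization.mk F Qv hQv ∉
      Set.range (phiProj W (k := 5) (by norm_num)))
    (hadd : ∀ a : Fin 5 → F, a ≠ 0 → OnHyp a (Projectivization.mk F Qv hQv) →
      Set.ncard {p ∈ Set.range (phiProj W (k := 5) (by norm_num)) | OnHyp a p} ≠ 5) :
    Qv 4 * Qv 1 ≠ 0 ∧ Qv 3 = 0 ∧ W.toAffine.Equation 0 (Qv 4 / Qv 1) := by
  exfalso
  have h2 : (2 : F) ≠ 0 := two_ne_zero_of_odd hodd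
  obtain ⟨e₁, e₂, e₃, h12, h13, h23, he₁, he₂, he₃⟩ := hlineY
  rw [equation_iff_of_canonical ha₁ ha₃] at he₁ he₂ he₃
  have hfac := cubic_eq_prod h12 h13 h23 (p := W.a₂) (r := W.a₄) (s := W.a₆)
    (by linear_combination -he₁) (by linear_combination -he₂) (by linear_combination -he₃)
  have hj' : W.a₂ ^ 2 - 3 * W.a₄ ≠ 0 := by
    intro h
    refine hj (W.j_eq_zero ?_)
    simp only [c₄, b₂, b₄, ha₁, ha₃]
    linear_combination 16 * h
  have hdisc : cubicDisc W.a₂ W.a₄ W.a₆ ≠ 0 := by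
    intro h
    refine W.isUnit_Δ.ne_zero ?_
    simp only [WeierstrassCurve.Δ, b₂, b₄, b₆, b₈, ha₁, ha₃]
    unfold cubicDisc at h
    linear_combination 16 * h
  have hder : 3 * e₁ ^ 2 + 2 * W.a₂ * e₁ + W.a₄ ≠ 0 := fun h =>
    tangent_ne_zero h2 hdisc he₁ ⟨h, by ring⟩
  have hlow := le_card_affinePoints hq hodd h12 h13 h23 hfac hder
  have hup := card_affinePoints_le_of_avoids hq hodd (Q₁ := Qv 0) (Q₂ := Qv 1) (Q₃ := Qv 2)
    (Q₄ := Qv 3) (Q₅ := Qv 4) hj' hdisc (by omega) ?_ ?_ ?_ ?_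
  · have hne := card_ne_123 (F := F)
    obtain ⟨m, hm⟩ := hodd
    omega
  · intro z s hs hz t k x₁ x₂ x₃ h12 h13 h23 h1z h2z h3z e₁ e₂ e₃ h
    refine hadd ![z * k, z * t - k, -z, -t, 1] (fun h => by simpa using congrFun h 4)
      ((onHyp_mk _ _ _).2 ?_) ?_
    · simp [Fin.sum_univ_succ]
      linear_combination h
    · rw [ncard_hyperplane_section]
      exact ncard_section_eq_five_of_line h2 ha₁ ha₃ hs hz h12 h13 h23 h1z h2z h3z e₁ e₂ e₃
  · intro z s x₁ s₁ hs hz hs₁ hx₁ hne h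
    refine hadd ![z * x₁, -(z + x₁), 0, 1, 0] (fun h => by simpa using congrFun h 3)
      ((onHyp_mk _ _ _).2 ?_) ?_
    · simp [Fin.sum_univ_succ]
      linear_combination h
    · rw [ncard_hyperplane_section]
      exact ncard_section_eq_five_of_vertical h2 ha₁ ha₃ hs hz hs₁ hx₁ hne
  · rintro l x y hl hxy ⟨h0, h1, h2, h3, h4⟩
    refine hQnotin ⟨.some x y (Affine.equation_iff_nonsingular.1
      ((equation_iff_of_canonical ha₁ ha₃ x y).2 hxy)), ?_⟩
    refine (Projectivization.mk_eq_mk_iff' F _ _ _ _).2 ⟨l⁻¹, ?_⟩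
    rw [phiVec_five_some]
    ext i
    fin_cases i <;> simp [h0, h1, h2, h3, h4, hl]
  · rintro ⟨h0, h1, h2, h3⟩
    have h4 : Qv 4 ≠ 0 := by
      intro h4
      apply hQv
      ext i
      fin_cases i <;> simp [h0, h1, h2, h3, h4]
    refine hQnotin ⟨.zero, (Projectivization.mk_eq_mk_iff' F _ _ _ _).2 ⟨(Qv 4)⁻¹, ?_⟩⟩
    rw [phiVec_five_zero]
    ext i
    fin_cases i <;> simp [h0, h1, h2, h3, h4]

end NMDS
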